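/- arXiv:0707.3122 — 3 statements merged into one kernel-verified Lean document; each statement's English description precedes it below -/
import Mathlib

section
/- Let Θ be an inner function in H^∞_{L(E)}(𝔻) with dim E < ∞ such that Θ·H²_E(𝔻) has finite codimension in H²_E(𝔻). Then det Θ is a finite Blaschke product; in particular dim H²(𝔻)/(det Θ)H²(𝔻) < ∞. -/
open MeasureTheory Real Complex Metric Filter Set

noncomputable section

/-- Membership in the vector-valued Hardy space `H²_E(𝔻)` (`E = ℂ^n`). -/
def MemH2V (n : ℕ) (f : ℂ → (Fin n → ℂ)) : Prop :=
  DifferentiableOn ℂ f (ball (0 : ℂ) 1) ∧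
    ∃ C : ℝ, ∀ r ∈ Ico (0 : ℝ) 1,
      (∫ t in Ioc (0 : ℝ) (2 * π), ‖f ((r : ℂ) * Complex.exp (t * Complex.I))‖ ^ 2) ≤ C

/-- Membership in the scalar Hardy space `H²(𝔻)`. -/
def MemH2S (f : ℂ → ℂ) : Prop :=
  DifferentiableOn ℂ f (ball (0 : ℂ) 1) ∧
    ∃ C : ℝ, ∀ r ∈ Ico (0 : ℝ) 1,
      (∫ t in Ioc (0 : ℝ) (2 * π), ‖f ((r : ℂ) * Complex.exp (t * Complex.I))‖ ^ 2) ≤ C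

/-- A bounded holomorphic function on the unit disc whose radial limits have modulus one
almost everywhere. -/
structure RadialInner (f : ℂ → ℂ) : Prop where
  diff : DifferentiableOn ℂ f (ball 0 1)
  bdd : ∃ C : ℝ, ∀ z ∈ ball (0 : ℂ) 1, ‖f z‖ ≤ C
  radial : ∀ᵐ t : ℝ, Tendsto (fun r : ℝ => ‖f (circleMap 0 r t)‖) (nhdsWithin 1 (Iio 1)) (nhds 1)

theorem circleMap_mem_unit_ball {r : ℝ} (h0 : 0 ≤ r) (h1 : r < 1) (t : ℝ) :
    circleMap 0 r t ∈ ball (0 : ℂ) 1 := by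
  simpa [abs_of_nonneg h0] using h1

theorem ContinuousOn.continuous_comp_circleMap {X : Type*} [TopologicalSpace X] {g : ℂ → X}
    (hg : ContinuousOn g (ball 0 1)) {r : ℝ} (h0 : 0 ≤ r) (h1 : r < 1) :
    Continuous fun t => g (circleMap 0 r t) :=
  hg.comp_continuous (continuous_circleMap 0 r) (circleMap_mem_unit_ball h0 h1)

theorem eventually_mem_Ioo_nhdsLT_one {b : ℝ} (hb : b < 1) :
    ∀ᶠ r : ℝ in nhdsWithin 1 (Iio 1), b < r ∧ r < 1 :=
  Ioo_mem_nhdsLT hb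

theorem norm_mul_sub_le_integral_norm {f : ℂ → ℂ} (hf : DifferentiableOn ℂ f (ball 0 1))
    {z : ℂ} {r : ℝ} (hz : ‖z‖ < r) (hr : r < 1) :
    2 * π * ‖f z‖ * (r - ‖z‖) ≤ ∫ t in 0..2 * π, ‖f (circleMap 0 r t)‖ := by
  have h0 : 0 < r := (norm_nonneg z).trans_lt hz
  have hd : DiffContOnCl ℂ f (ball 0 r) := by
    apply DifferentiableOn.diffContOnCl
    rw [closure_ball _ h0.ne']
    exact hf.mono (closedBall_subset_ball hr)
  have hcauchy := hd.circleIntegral_sub_inv_smul (w := z) (by simpa using hz)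
  have hnorm := congrArg norm hcauchy
  have hpos : 0 < r - ‖z‖ := sub_pos.2 hz
  have key : 2 * π * ‖f z‖ ≤ ∫ t in 0..2 * π, (r - ‖z‖)⁻¹ * ‖f (circleMap 0 r t)‖ := by
    have : ‖(2 * (π : ℂ) * I) • f z‖ = 2 * π * ‖f z‖ := by
      simp [abs_of_pos pi_pos]
    rw [← this, ← hnorm, circleIntegral]
    have hc := hf.continuousOn.continuous_comp_circleMap h0.le hr
    refine intervalIntegral.norm_integral_le_of_norm_le (by positivity) ?_
      ((continuous_const.mul hc.norm).intervalIntegrable _ _)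
    refine Eventually.of_forall fun t _ => ?_
    have h1 : r - ‖z‖ ≤ ‖circleMap 0 r t - z‖ := by
      have := norm_sub_norm_le (circleMap 0 r t) z
      simpa [abs_of_pos h0] using this
    simp only [deriv_circleMap, norm_smul, norm_mul, norm_inv, norm_circleMap_zero, norm_I,
      abs_of_pos h0, mul_one]
    have h2 : ‖circleMap 0 r t - z‖⁻¹ ≤ (r - ‖z‖)⁻¹ := inv_anti₀ hpos h1
    calc r * (‖circleMap 0 r t - z‖⁻¹ * ‖f (circleMap 0 r t)‖)
        ≤ 1 * ((r - ‖z‖)⁻¹ * ‖f (circleMap 0 r t)‖) := by gcongr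
      _ = _ := one_mul _
  rw [intervalIntegral.integral_const_mul, inv_mul_eq_div, le_div_iff₀ hpos] at key
  exact key

theorem RadialInner.norm_pow_mul_le_one {f : ℂ → ℂ} (hf : RadialInner f) {z : ℂ}
    (hz : z ∈ ball (0 : ℂ) 1) (N : ℕ) : ‖f z‖ ^ N * (1 - ‖z‖) ≤ 1 := by
  obtain ⟨C, hC⟩ := hf.bdd
  have hz' : ‖z‖ < 1 := by simpa using hz
  have hlim : Tendsto (fun r : ℝ => ∫ t in 0..2 * π, ‖f (circleMap 0 r t) ^ N‖)
      (nhdsWithin 1 (Iio 1)) (nhds (∫ _ in 0..2 * π, (1 : ℝ))) := by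
    refine intervalIntegral.tendsto_integral_filter_of_dominated_convergence (fun _ => C ^ N)
      ?_ ?_ (by simp) ?_
    · filter_upwards [eventually_mem_Ioo_nhdsLT_one zero_lt_one] with r hr
      have hc := hf.diff.continuousOn.continuous_comp_circleMap hr.1.le hr.2
      exact (hc.pow N).norm.aestronglyMeasurable
    · filter_upwards [eventually_mem_Ioo_nhdsLT_one zero_lt_one] with r hr
      refine Eventually.of_forall fun t _ => ?_
      rw [norm_norm, norm_pow]
      exact pow_le_pow_left₀ (norm_nonneg _) (hC _ (circleMap_mem_unit_ball hr.1.le hr.2 t)) N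
    · filter_upwards [hf.radial] with t ht _
      simpa using ht.pow N
  have hleft : Tendsto (fun r : ℝ => 2 * π * ‖f z ^ N‖ * (r - ‖z‖)) (nhdsWithin 1 (Iio 1))
      (nhds (2 * π * ‖f z ^ N‖ * (1 - ‖z‖))) :=
    ((continuous_const.mul (continuous_id.sub continuous_const)).tendsto 1).mono_left
      nhdsWithin_le_nhds
  have hle := le_of_tendsto_of_tendsto hleft hlim (by
    filter_upwards [eventually_mem_Ioo_nhdsLT_one hz'] with r hr
    exact norm_mul_sub_le_integral_norm (hf.diff.pow N) hr.1 hr.2)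
  simp only [intervalIntegral.integral_const, sub_zero, smul_eq_mul, mul_one, norm_pow] at hle
  have hp : 0 < 2 * π := by positivity
  nlinarith

theorem RadialInner.norm_le_one {f : ℂ → ℂ} (hf : RadialInner f) {z : ℂ}
    (hz : z ∈ ball (0 : ℂ) 1) : ‖f z‖ ≤ 1 := by
  by_contra! h
  have hz' : 0 < 1 - ‖z‖ := by simpa using hz
  obtain ⟨N, hN⟩ := pow_unbounded_of_one_lt (1 - ‖z‖)⁻¹ h
  have := hf.norm_pow_mul_le_one hz N
  rw [inv_eq_one_div, div_lt_iff₀ hz'] at hN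
  linarith

theorem abs_sin_sub_arg_le_norm_circleMap_sub {r : ℝ} (hr : 1 / 2 ≤ r) (t : ℝ) (a : ℂ) :
    |Real.sin (t - a.arg)| / 2 ≤ ‖circleMap 0 r t - a‖ := by
  have h1 : (circleMap 0 r t - a) * Complex.exp (-(a.arg * I))
      = r * Complex.exp (((t - a.arg : ℝ) : ℂ) * I) - (‖a‖ : ℂ) := by
    have ha : a * Complex.exp (-(a.arg * I)) = (‖a‖ : ℂ) := by
      nth_rewrite 1 [← Complex.norm_mul_exp_arg_mul_I a]
      rw [mul_assoc, ← Complex.exp_add, add_neg_cancel, Complex.exp_zero, mul_one]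
    rw [sub_mul, ha, circleMap_zero, mul_assoc, ← Complex.exp_add]
    congr 3
    push_cast
    ring
  have h2 : ‖circleMap 0 r t - a‖
      = ‖(r * Complex.exp (((t - a.arg : ℝ) : ℂ) * I) - (‖a‖ : ℂ))‖ := by
    rw [← h1, norm_mul, ← neg_mul, ← Complex.ofReal_neg, Complex.norm_exp_ofReal_mul_I, mul_one]
  rw [h2]
  refine le_trans ?_ (Complex.abs_im_le_norm _)
  rw [Complex.sub_im, Complex.ofReal_im, sub_zero, Complex.im_ofReal_mul,
    Complex.exp_ofReal_mul_I_im, abs_mul,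
    abs_of_nonneg (a := r) (by linarith)]
  nlinarith [abs_nonneg (Real.sin (t - a.arg))]

theorem ae_sin_sub_ne_zero (θ : ℝ) : ∀ᵐ t : ℝ, Real.sin (t - θ) ≠ 0 := by
  have : {t : ℝ | ¬ Real.sin (t - θ) ≠ 0} ⊆ range fun n : ℤ => (n : ℝ) * π + θ := by
    intro t ht
    simp only [ne_eq, not_not, mem_ofPred_eq] at ht
    obtain ⟨n, hn⟩ := Real.sin_eq_zero_iff.1 ht
    exact ⟨n, by simp only; linarith⟩
  exact measure_mono_null this ((countable_range _).measure_zero _)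

theorem intervalIntegrable_log_abs_sin_sub (θ a b : ℝ) :
    IntervalIntegrable (fun t => Real.log |Real.sin (t - θ)|) volume a b := by
  have := (intervalIntegrable_log_sin (a := a - θ) (b := b - θ)).comp_sub_right θ
  simpa [Function.comp_def] using this

theorem exists_integrable_log_norm_sub_majorant (a : ℂ) :
    ∃ D : ℝ → ℝ, IntervalIntegrable D volume 0 (2 * π) ∧
      ∀ᵐ t : ℝ, ∀ r : ℝ, 1 / 2 ≤ r → circleMap 0 r t - a ≠ 0 ∧
        -Real.log ‖circleMap 0 r t - a‖ ≤ D t := by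
  refine ⟨fun t => Real.log 2 - Real.log |Real.sin (t - a.arg)|,
    intervalIntegrable_const.sub (intervalIntegrable_log_abs_sin_sub _ _ _), ?_⟩
  filter_upwards [ae_sin_sub_ne_zero a.arg] with t ht r hr
  have h := abs_sin_sub_arg_le_norm_circleMap_sub hr t a
  have hpos : 0 < |Real.sin (t - a.arg)| / 2 := by positivity
  refine ⟨norm_pos_iff.1 (hpos.trans_le h), ?_⟩
  have := Real.log_le_log hpos h
  rw [Real.log_div (by positivity) two_ne_zero] at this
  linarith

theorem exists_integrable_log_norm_prod_majorant (s : Multiset ℂ) :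
    ∃ D : ℝ → ℝ, IntervalIntegrable D volume 0 (2 * π) ∧
      ∀ᵐ t : ℝ, ∀ r : ℝ, 1 / 2 ≤ r → (s.map fun a => circleMap 0 r t - a).prod ≠ 0 ∧
        -Real.log ‖(s.map fun a => circleMap 0 r t - a).prod‖ ≤ D t := by
  induction s using Multiset.induction with
  | empty => exact ⟨fun _ => 0, intervalIntegrable_const, by simp⟩
  | cons a s ih =>
    obtain ⟨D, hD, h⟩ := ih
    obtain ⟨D', hD', h'⟩ := exists_integrable_log_norm_sub_majorant a
    refine ⟨fun t => D' t + D t, hD'.add hD, ?_⟩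
    filter_upwards [h, h'] with t ht ht' r hr
    obtain ⟨h1, h2⟩ := ht r hr
    obtain ⟨h3, h4⟩ := ht' r hr
    rw [Multiset.map_cons, Multiset.prod_cons, norm_mul,
      Real.log_mul (norm_ne_zero_iff.2 h3) (norm_ne_zero_iff.2 h1)]
    exact ⟨mul_ne_zero h3 h1, by linarith⟩

theorem Polynomial.exists_integrable_log_norm_eval_majorant {Q : Polynomial ℂ} (hQ : Q ≠ 0) :
    ∃ D : ℝ → ℝ, IntervalIntegrable D volume 0 (2 * π) ∧
      ∀ᵐ t : ℝ, ∀ r : ℝ, 1 / 2 ≤ r → Q.eval (circleMap 0 r t) ≠ 0 ∧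
        -Real.log ‖Q.eval (circleMap 0 r t)‖ ≤ D t := by
  obtain ⟨D, hD, h⟩ := exists_integrable_log_norm_prod_majorant Q.roots
  have hl : Q.leadingCoeff ≠ 0 := Polynomial.leadingCoeff_ne_zero.2 hQ
  have heval (z : ℂ) : Q.eval z = Q.leadingCoeff * (Q.roots.map fun a => z - a).prod :=
    (IsAlgClosed.splits Q).eval_eq_prod_roots z
  refine ⟨fun t => D t - Real.log ‖Q.leadingCoeff‖, hD.sub intervalIntegrable_const, ?_⟩
  filter_upwards [h] with t ht r hr
  obtain ⟨h1, h2⟩ := ht r hr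
  rw [heval, norm_mul, Real.log_mul (norm_ne_zero_iff.2 hl) (norm_ne_zero_iff.2 h1)]
  exact ⟨mul_ne_zero hl h1, by linarith⟩

theorem Real.log_one_add_sq_le {x : ℝ} (hx : 0 ≤ x) : Real.log (1 + x) ^ 2 ≤ 2 * x := by
  have h := Real.quadratic_le_exp_of_nonneg (Real.log_nonneg (by linarith : 1 ≤ 1 + x))
  rw [Real.exp_log (by linarith)] at h
  linarith [Real.log_nonneg (by linarith : 1 ≤ 1 + x)]

theorem integral_neg_log_norm_of_ne_zero {s : ℂ → ℂ}
    (hs : DifferentiableOn ℂ s (ball 0 1)) (h0 : ∀ z ∈ ball (0 : ℂ) 1, s z ≠ 0) {r : ℝ}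
    (hr0 : 0 ≤ r) (hr1 : r < 1) :
    ∫ t in 0..2 * π, -Real.log ‖s (circleMap 0 r t)‖ = 2 * π * -Real.log ‖s 0‖ := by
  have hsub : closedBall (0 : ℂ) |r| ⊆ ball 0 1 := by
    rw [abs_of_nonneg hr0]; exact closedBall_subset_ball hr1
  have h := AnalyticOnNhd.circleAverage_log_norm_of_ne_zero (R := r) (c := 0) (g := s)
    ((hs.analyticOnNhd isOpen_ball).mono hsub) fun u hu => h0 u (hsub hu)
  rw [Real.circleAverage_def, smul_eq_mul, inv_mul_eq_iff_eq_mul₀ (by positivity)] at h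
  rw [intervalIntegral.integral_neg, h, mul_neg]

theorem le_min_add_sq_div {u a b M : ℝ} (hM : 0 < M) (h : u ≤ a + b) :
    u ≤ min u (a + M) + b ^ 2 / M := by
  rcases le_total u (a + M) with h1 | h1
  · rw [min_eq_left h1]
    have : 0 ≤ b ^ 2 / M := by positivity
    linarith
  · rw [min_eq_right h1]
    have : b ≤ b ^ 2 / M := by
      rw [le_div_iff₀ hM]
      nlinarith
    linarith

/-- A zero-free inner function `s` with `‖Q‖ ≤ C ‖s‖ (1 + w) ^ N` for a nonzero polynomial `Q` and
a nonnegative function `w` with bounded circle means satisfies `1 ≤ ‖s 0‖`. -/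
theorem RadialInner.log_norm_zero_nonneg {s : ℂ → ℂ} (hs : RadialInner s)
    (h0 : ∀ z ∈ ball (0 : ℂ) 1, s z ≠ 0) {Q : Polynomial ℂ} (hQ : Q ≠ 0) {w : ℂ → ℝ}
    (hw : ContinuousOn w (ball 0 1)) (hw0 : ∀ z, 0 ≤ w z) {K : ℝ}
    (hK : ∀ r ∈ Ico (0 : ℝ) 1, ∫ t in 0..2 * π, w (circleMap 0 r t) ≤ K) {C : ℝ} {N : ℕ}
    (hle : ∀ z ∈ ball (0 : ℂ) 1, ‖Q.eval z‖ ≤ C * ‖s z‖ * (1 + w z) ^ N) :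
    0 ≤ Real.log ‖s 0‖ := by
  obtain ⟨D, hD, hDle⟩ := Q.exists_integrable_log_norm_eval_majorant hQ
  set a : ℝ → ℝ := fun t => |Real.log C + D t| with ha
  have hai : IntervalIntegrable a volume 0 (2 * π) := (intervalIntegrable_const.add hD).abs
  set u : ℝ → ℝ → ℝ := fun r t => -Real.log ‖s (circleMap 0 r t)‖ with hu
  have hucont : ∀ r, 0 ≤ r → r < 1 → Continuous (u r) := fun r hr0 hr1 =>
    ((hs.diff.continuousOn.continuous_comp_circleMap hr0 hr1).norm.log fun t =>
      norm_ne_zero_iff.2 (h0 _ (circleMap_mem_unit_ball hr0 hr1 t))).neg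
  have hu0 : ∀ r, 0 ≤ r → r < 1 → ∀ t, 0 ≤ u r t := fun r hr0 hr1 t =>
    neg_nonneg.2 (Real.log_nonpos (norm_nonneg _)
      (hs.norm_le_one (circleMap_mem_unit_ball hr0 hr1 t)))
  have huint : ∀ r, 0 ≤ r → r < 1 → ∫ t in 0..2 * π, u r t = 2 * π * -Real.log ‖s 0‖ :=
    fun r hr0 hr1 => integral_neg_log_norm_of_ne_zero hs.diff h0 hr0 hr1
  have hule : ∀ᵐ t : ℝ, ∀ r, 1 / 2 ≤ r → r < 1 →
      u r t ≤ a t + N * Real.log (1 + w (circleMap 0 r t)) := by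
    filter_upwards [hDle] with t ht r hr hr1
    obtain ⟨hne, hlog⟩ := ht r hr
    have hmem := circleMap_mem_unit_ball (by linarith : 0 ≤ r) hr1 t
    have hb := hle _ hmem
    have hQpos := norm_pos_iff.2 hne
    have hspos := norm_pos_iff.2 (h0 _ hmem)
    have hwpos : 0 < 1 + w (circleMap 0 r t) := by linarith [hw0 (circleMap 0 r t)]
    have hCpos : 0 < C := by
      by_contra! hC
      have h1 : C * ‖s (circleMap 0 r t)‖ * (1 + w (circleMap 0 r t)) ^ N ≤ 0 :=
        mul_nonpos_of_nonpos_of_nonneg (mul_nonpos_of_nonpos_of_nonneg hC hspos.le)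
          (by positivity)
      linarith
    have := Real.log_le_log hQpos hb
    rw [Real.log_mul (by positivity) (by positivity), Real.log_mul hCpos.ne' hspos.ne',
      Real.log_pow] at this
    have habs := le_abs_self (Real.log C + D t)
    simp only [ha, hu]
    linarith
  have hbound : ∀ M : ℝ, 0 < M → 2 * π * -Real.log ‖s 0‖ ≤ N ^ 2 * 2 * K / M := by
    intro M hM
    have hlim : Tendsto (fun r : ℝ => ∫ t in 0..2 * π, min (u r t) (a t + M))
        (nhdsWithin 1 (Iio 1)) (nhds (∫ _ in 0..2 * π, (0 : ℝ))) := by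
      refine intervalIntegral.tendsto_integral_filter_of_dominated_convergence
        (fun t => a t + M) ?_ ?_ (hai.add intervalIntegrable_const) ?_
      · filter_upwards [eventually_mem_Ioo_nhdsLT_one zero_lt_one] with r hr
        exact (hucont r hr.1.le hr.2).aestronglyMeasurable.inf
          (hai.add intervalIntegrable_const).def'.aestronglyMeasurable
      · filter_upwards [eventually_mem_Ioo_nhdsLT_one zero_lt_one] with r hr
        refine Eventually.of_forall fun t _ => ?_
        have : 0 ≤ min (u r t) (a t + M) :=
          le_min (hu0 r hr.1.le hr.2 t) (by positivity)
        rw [Real.norm_of_nonneg this]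
        exact min_le_right _ _
      · filter_upwards [hs.radial] with t ht _
        have h1 : Tendsto (fun r => u r t) (nhdsWithin 1 (Iio 1)) (nhds 0) := by
          simpa using (ht.log one_ne_zero).neg
        have h2 := h1.min (tendsto_const_nhds (x := a t + M))
        rwa [min_eq_left (by positivity)] at h2
    have hlim' := hlim.add (tendsto_const_nhds (x := (N : ℝ) ^ 2 * 2 * K / M))
    rw [intervalIntegral.integral_zero, zero_add] at hlim'
    refine ge_of_tendsto hlim' ?_
    filter_upwards [eventually_mem_Ioo_nhdsLT_one (by norm_num : (1 / 2 : ℝ) < 1)] with r hr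
    have hr0 : 0 ≤ r := by linarith
    have hwc := hw.continuous_comp_circleMap hr0 hr.2
    have hI1 : IntervalIntegrable (fun t => min (u r t) (a t + M)) volume 0 (2 * π) :=
      ⟨((hucont r hr0 hr.2).intervalIntegrable _ _).1.inf
        (hai.add intervalIntegrable_const).1,
       ((hucont r hr0 hr.2).intervalIntegrable _ _).2.inf
        (hai.add intervalIntegrable_const).2⟩
    have hI2 : IntervalIntegrable (fun t => (N : ℝ) ^ 2 * 2 / M * w (circleMap 0 r t))
        volume 0 (2 * π) := (hwc.const_mul _).intervalIntegrable _ _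
    calc 2 * π * -Real.log ‖s 0‖ = ∫ t in 0..2 * π, u r t := (huint r hr0 hr.2).symm
      _ ≤ ∫ t in 0..2 * π,
            (min (u r t) (a t + M) + (N : ℝ) ^ 2 * 2 / M * w (circleMap 0 r t)) := by
          refine intervalIntegral.integral_mono_ae (by positivity)
            ((hucont r hr0 hr.2).intervalIntegrable _ _) (hI1.add hI2) ?_
          filter_upwards [hule] with t ht
          refine (le_min_add_sq_div hM (ht r hr.1.le hr.2)).trans ?_
          rw [mul_pow, div_mul_eq_mul_div, mul_assoc]
          gcongr
          exact Real.log_one_add_sq_le (hw0 _)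
      _ = (∫ t in 0..2 * π, min (u r t) (a t + M))
            + (N : ℝ) ^ 2 * 2 / M * ∫ t in 0..2 * π, w (circleMap 0 r t) := by
          rw [intervalIntegral.integral_add hI1 hI2, intervalIntegral.integral_const_mul]
      _ ≤ _ := by
          rw [mul_div_right_comm ((N : ℝ) ^ 2 * 2) K M]
          gcongr
          exact hK r ⟨hr0, hr.2⟩
  have hnonpos : 2 * π * -Real.log ‖s 0‖ ≤ 0 := by
    have hlim : Tendsto (fun M : ℝ => (N : ℝ) ^ 2 * 2 * K / M) atTop (nhds 0) :=
      tendsto_const_nhds.div_atTop tendsto_id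
    refine ge_of_tendsto hlim ?_
    filter_upwards [eventually_gt_atTop 0] with M hM using hbound M hM
  have hp : 0 < 2 * π := by positivity
  nlinarith

theorem RadialInner.exists_eq_const {s : ℂ → ℂ} (hs : RadialInner s)
    (h0 : 1 ≤ ‖s 0‖) : ‖s 0‖ = 1 ∧ ∀ z ∈ ball (0 : ℂ) 1, s z = s 0 := by
  have h00 : (0 : ℂ) ∈ ball (0 : ℂ) 1 := by simp
  refine ⟨le_antisymm (hs.norm_le_one h00) h0, fun z hz => ?_⟩
  exact Complex.eqOn_of_isPreconnected_of_isMaxOn_norm (convex_ball 0 1).isPreconnected isOpen_ball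
    hs.diff h00 (fun z hz => (hs.norm_le_one hz).trans h0) hz

theorem one_sub_conj_mul_ne_zero {a z : ℂ} (ha : ‖a‖ < 1) (hz : ‖z‖ ≤ 1) :
    1 - (starRingEnd ℂ) a * z ≠ 0 := by
  intro h
  have h1 : ‖(starRingEnd ℂ) a * z‖ = 1 := by rw [← sub_eq_zero.1 h, norm_one]
  rw [norm_mul, RCLike.norm_conj] at h1
  nlinarith [norm_nonneg a, norm_nonneg z]

theorem norm_one_sub_conj_mul_of_norm_eq_one (a : ℂ) {z : ℂ} (hz : ‖z‖ = 1) :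
    ‖1 - (starRingEnd ℂ) a * z‖ = ‖z - a‖ := by
  have h : 1 - (starRingEnd ℂ) a * z = (starRingEnd ℂ) (z - a) * z := by
    rw [map_sub, sub_mul, Complex.conj_mul', hz]
    simp
  rw [h, norm_mul, RCLike.norm_conj, hz, mul_one]

theorem norm_one_sub_conj_mul_le_two {a z : ℂ} (ha : ‖a‖ < 1) (hz : ‖z‖ < 1) :
    ‖1 - (starRingEnd ℂ) a * z‖ ≤ 2 := by
  have h := norm_sub_le 1 ((starRingEnd ℂ) a * z)
  rw [norm_one, norm_mul, RCLike.norm_conj] at h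
  nlinarith [norm_nonneg a, norm_nonneg z]

/-- The quotient of `f - f a` by the Blaschke factor at `a`. -/
def blaschkeQuotient (f : ℂ → ℂ) (a z : ℂ) : ℂ :=
  dslope f a z * (1 - (starRingEnd ℂ) a * z)

theorem differentiableOn_blaschkeQuotient {f : ℂ → ℂ} (hf : DifferentiableOn ℂ f (ball 0 1))
    {a : ℂ} (ha : ‖a‖ < 1) : DifferentiableOn ℂ (blaschkeQuotient f a) (ball 0 1) := by
  have ha' : ball (0 : ℂ) 1 ∈ nhds a := isOpen_ball.mem_nhds (by simpa using ha)
  exact ((Complex.differentiableOn_dslope ha').2 hf).mul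
    (by fun_prop)

theorem blaschke_mul_blaschkeQuotient (f : ℂ → ℂ) {a z : ℂ} (ha : ‖a‖ < 1) (hz : ‖z‖ < 1) :
    (z - a) / (1 - (starRingEnd ℂ) a * z) * blaschkeQuotient f a z = f z - f a := by
  have h := one_sub_conj_mul_ne_zero ha hz.le
  have h2 := sub_smul_dslope f a z
  rw [smul_eq_mul] at h2
  rw [blaschkeQuotient, ← h2]
  generalize 1 - (starRingEnd ℂ) a * z = d at h ⊢
  field_simp

theorem exists_norm_blaschkeQuotient_le {f : ℂ → ℂ} (hf : DifferentiableOn ℂ f (ball 0 1))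
    {a : ℂ} (ha : ‖a‖ < 1) :
    ∃ C : ℝ, 0 ≤ C ∧ ∀ z ∈ ball (0 : ℂ) 1, ‖blaschkeQuotient f a z‖ ≤ C * (1 + ‖f z‖) := by
  set ρ : ℝ := (1 + ‖a‖) / 2 with hρ
  have hρ1 : ρ < 1 := by linarith
  have hρa : 0 < ρ - ‖a‖ := by linarith
  obtain ⟨C₁, hC₁⟩ := (isCompact_closedBall (0 : ℂ) ρ).exists_bound_of_continuousOn
    ((differentiableOn_blaschkeQuotient hf ha).continuousOn.mono (closedBall_subset_ball hρ1))
  have hC₁0 : 0 ≤ C₁ := (norm_nonneg _).trans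
    (hC₁ 0 (mem_closedBall_self (by linarith [norm_nonneg a])))
  refine ⟨C₁ + 2 * (1 + ‖f a‖) / (ρ - ‖a‖), by positivity, fun z hz => ?_⟩
  have hz1 : ‖z‖ < 1 := by simpa using hz
  have hX : 0 ≤ 2 * (1 + ‖f a‖) / (ρ - ‖a‖) := by positivity
  rcases le_or_gt ‖z‖ ρ with h | h
  · have := hC₁ z (by simpa using h)
    nlinarith [norm_nonneg (f z)]
  · have hza : ρ - ‖a‖ ≤ ‖z - a‖ := by linarith [norm_sub_norm_le z a]
    have hne : z - a ≠ 0 := norm_pos_iff.1 (hρa.trans_le hza)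
    have hq : blaschkeQuotient f a z = (f z - f a) * (1 - (starRingEnd ℂ) a * z) / (z - a) := by
      rw [← blaschke_mul_blaschkeQuotient f ha hz1]
      have h := one_sub_conj_mul_ne_zero ha hz1.le
      generalize 1 - (starRingEnd ℂ) a * z = d at h ⊢
      field_simp
    have h2 := norm_one_sub_conj_mul_le_two ha hz1
    calc ‖blaschkeQuotient f a z‖
        = ‖f z - f a‖ * ‖1 - (starRingEnd ℂ) a * z‖ / ‖z - a‖ := by rw [hq, norm_div, norm_mul]
      _ ≤ ((1 + ‖f a‖) * (1 + ‖f z‖)) * 2 / (ρ - ‖a‖) := by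
          gcongr
          nlinarith [norm_sub_le (f z) (f a), norm_nonneg (f z), norm_nonneg (f a)]
      _ = 2 * (1 + ‖f a‖) / (ρ - ‖a‖) * (1 + ‖f z‖) := by ring
      _ ≤ _ := by gcongr; linarith

theorem RadialInner.blaschkeQuotient {f : ℂ → ℂ} (hf : RadialInner f) {a : ℂ} (ha : ‖a‖ < 1)
    (hfa : f a = 0) : RadialInner (blaschkeQuotient f a) where
  diff := differentiableOn_blaschkeQuotient hf.diff ha
  bdd := by
    obtain ⟨C, hC0, hC⟩ := exists_norm_blaschkeQuotient_le hf.diff ha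
    obtain ⟨B, hB⟩ := hf.bdd
    exact ⟨C * (1 + B), fun z hz => (hC z hz).trans (by gcongr; exact hB z hz)⟩
  radial := by
    filter_upwards [hf.radial] with t ht
    have h1 : ‖circleMap 0 1 t‖ = 1 := by simp
    have hne : circleMap 0 1 t - a ≠ 0 := by
      rw [sub_ne_zero]
      rintro rfl
      exact ha.ne h1
    have hc : Tendsto (fun r : ℝ => circleMap 0 r t) (nhdsWithin 1 (Iio 1))
        (nhds (circleMap 0 1 t)) := by
      have : Continuous fun r : ℝ => circleMap 0 r t := by
        unfold circleMap; fun_prop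
      exact (this.tendsto 1).mono_left nhdsWithin_le_nhds
    have hlim := (ht.mul ((tendsto_const_nhds (x := (1 : ℂ))).sub
      (hc.const_mul ((starRingEnd ℂ) a))).norm).div (hc.sub_const a).norm (norm_ne_zero_iff.2 hne)
    rw [norm_one_sub_conj_mul_of_norm_eq_one a h1, one_mul,
      div_self (norm_ne_zero_iff.2 hne)] at hlim
    refine hlim.congr' ?_
    filter_upwards [eventually_mem_Ioo_nhdsLT_one ha] with r hr
    have hr0 : 0 ≤ r := (norm_nonneg a).trans hr.1.le
    have hz : ‖circleMap 0 r t‖ < 1 := by simpa [abs_of_nonneg hr0] using hr.2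
    have hza : circleMap 0 r t - a ≠ 0 := by
      rw [sub_ne_zero]
      intro h
      have := hr.1
      rw [← h, norm_circleMap_zero, abs_of_nonneg hr0] at this
      exact this.false
    have h := blaschke_mul_blaschkeQuotient f ha hz
    rw [hfa, sub_zero] at h
    simp only [Pi.div_apply]
    rw [← h, ← norm_mul, ← norm_div]
    have hd := one_sub_conj_mul_ne_zero ha hz.le
    congr 1
    generalize 1 - (starRingEnd ℂ) a * circleMap 0 r t = d at hd ⊢
    field_simp

theorem exists_norm_eval_le_blaschkeQuotient {f : ℂ → ℂ} (hf : DifferentiableOn ℂ f (ball 0 1))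
    {a : ℂ} (ha : ‖a‖ < 1) (hfa : f a = 0) {Q : Polynomial ℂ} {C : ℝ} {G : ℂ → ℝ}
    (hG : ContinuousOn G (ball 0 1))
    (hle : ∀ z ∈ ball (0 : ℂ) 1, ‖((Polynomial.X - Polynomial.C a) * Q).eval z‖
      ≤ C * ‖f z‖ * G z) :
    ∀ z ∈ ball (0 : ℂ) 1,
      ‖Q.eval z‖ * ‖1 - (starRingEnd ℂ) a * z‖ ≤ C * ‖blaschkeQuotient f a z‖ * G z := by
  have hne : ∀ z ∈ ball (0 : ℂ) 1, z ≠ a →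
      ‖Q.eval z‖ * ‖1 - (starRingEnd ℂ) a * z‖ ≤ C * ‖blaschkeQuotient f a z‖ * G z := by
    intro z hz hza
    have hz1 : ‖z‖ < 1 := by simpa using hz
    have h := hle z hz
    have hb := blaschke_mul_blaschkeQuotient f ha hz1
    rw [hfa, sub_zero] at hb
    have hd := norm_pos_iff.2 (one_sub_conj_mul_ne_zero ha hz1.le)
    have hpos : 0 < ‖z - a‖ := norm_pos_iff.2 (sub_ne_zero.2 hza)
    rw [← hb] at h
    simp only [Polynomial.eval_mul, Polynomial.eval_sub, Polynomial.eval_X, Polynomial.eval_C,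
      norm_mul, norm_div] at h
    have h' : ‖z - a‖ * ‖Q.eval z‖
        ≤ ‖z - a‖ * (C * ‖blaschkeQuotient f a z‖ * G z / ‖1 - (starRingEnd ℂ) a * z‖) :=
      h.trans_eq (by ring)
    exact (le_div_iff₀ hd).1 (le_of_mul_le_mul_left h' hpos)
  intro z hz
  by_cases hza : z = a
  · subst hza
    have hnhds : ball (0 : ℂ) 1 ∈ nhds z := isOpen_ball.mem_nhds hz
    have hq := (differentiableOn_blaschkeQuotient hf ha).continuousOn.continuousAt hnhds
    have h1 : ContinuousAt
        (fun x => ‖Q.eval x‖ * ‖1 - (starRingEnd ℂ) z * x‖) z := by fun_prop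
    have h2 : ContinuousAt (fun x => C * ‖blaschkeQuotient f z x‖ * G x) z :=
      (hq.norm.const_mul C).mul (hG.continuousAt hnhds)
    refine le_of_tendsto_of_tendsto (h1.tendsto.mono_left nhdsWithin_le_nhds)
      (h2.tendsto.mono_left nhdsWithin_le_nhds) (b := nhdsWithin z {z}ᶜ) ?_
    filter_upwards [mem_nhdsWithin_of_mem_nhds hnhds, self_mem_nhdsWithin] with x hx hxa
    exact hne x hx hxa
  · exact hne z hz hza

theorem RadialInner.exists_blaschke {w : ℂ → ℝ} (hw : ContinuousOn w (ball 0 1))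
    (hw0 : ∀ z, 0 ≤ w z) {K : ℝ}
    (hK : ∀ r ∈ Ico (0 : ℝ) 1, ∫ t in 0..2 * π, w (circleMap 0 r t) ≤ K) {N : ℕ}
    {f : ℂ → ℂ} (hf : RadialInner f) {Q : Polynomial ℂ} (hQ : Q ≠ 0) {C : ℝ}
    (hle : ∀ z ∈ ball (0 : ℂ) 1, ‖Q.eval z‖ ≤ C * ‖f z‖ * (1 + w z) ^ N) :
    ∃ (D : ℕ) (a : Fin D → ℂ) (c : ℂ), ‖c‖ = 1 ∧ (∀ j, ‖a j‖ < 1) ∧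
      ∀ z ∈ ball (0 : ℂ) 1, f z = c * ∏ j, (z - a j) / (1 - (starRingEnd ℂ) (a j) * z) := by
  induction hm : Q.natDegree using Nat.strong_induction_on generalizing Q f C with
  | _ m ih =>
  by_cases h0 : ∀ z ∈ ball (0 : ℂ) 1, f z ≠ 0
  · have hlog := hf.log_norm_zero_nonneg h0 hQ hw hw0 hK hle
    have h1 : 1 ≤ ‖f 0‖ :=
      (Real.log_nonneg_iff (norm_pos_iff.2 (h0 0 (by simp)))).1 hlog
    obtain ⟨hc, hconst⟩ := hf.exists_eq_const h1
    exact ⟨0, Fin.elim0, f 0, hc, fun j => j.elim0, fun z hz => by simpa using hconst z hz⟩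
  · push Not at h0
    obtain ⟨a, hamem, hfa⟩ := h0
    have ha : ‖a‖ < 1 := by simpa using hamem
    have hroot : Q.IsRoot a := by
      have := hle a hamem
      rw [hfa, norm_zero, mul_zero, zero_mul] at this
      exact norm_le_zero_iff.1 this
    obtain ⟨Q, rfl⟩ := Polynomial.dvd_iff_isRoot.2 hroot
    have hQ1 : Q ≠ 0 := right_ne_zero_of_mul hQ
    have hdeg : Q.natDegree < m := by
      rw [← hm, Polynomial.natDegree_mul (Polynomial.X_sub_C_ne_zero a) hQ1,
        Polynomial.natDegree_X_sub_C]
      lia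
    have hG : ContinuousOn (fun z => (1 + w z) ^ N) (ball 0 1) := (continuousOn_const.add hw).pow N
    have hle1 := exists_norm_eval_le_blaschkeQuotient hf.diff ha hfa hG hle
    obtain ⟨D, b, c, hc, hb, hprod⟩ := ih _ hdeg (hf.blaschkeQuotient ha hfa) hQ1
      (C := C / (1 - ‖a‖)) (fun z hz => by
        have hz1 : ‖z‖ < 1 := by simpa using hz
        have hpos : 0 < 1 - ‖a‖ := by linarith
        have hd : 1 - ‖a‖ ≤ ‖1 - (starRingEnd ℂ) a * z‖ := by
          have := norm_sub_norm_le 1 ((starRingEnd ℂ) a * z)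
          rw [norm_one, norm_mul, RCLike.norm_conj] at this
          nlinarith [norm_nonneg a, norm_nonneg z]
        have := hle1 z hz
        rw [div_mul_eq_mul_div, div_mul_eq_mul_div, le_div_iff₀ hpos]
        exact (by gcongr : _ ≤ _).trans this) rfl
    refine ⟨D + 1, Fin.cons a b, c, hc, fun j => ?_, fun z hz => ?_⟩
    · refine Fin.cases ?_ ?_ j
      · simpa using ha
      · simpa using hb
    · have hb := blaschke_mul_blaschkeQuotient f ha (by simpa using hz : ‖z‖ < 1)
      rw [hfa, sub_zero] at hb
      rw [Fin.prod_univ_succ, ← hb, hprod z hz]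
      simp only [Fin.cons_zero, Fin.cons_succ]
      ring

theorem exists_integral_sq_norm_le {ι E F : Type*} [Fintype ι] [NormedAddCommGroup E]
    [NormedAddCommGroup F] {f : ι → ℂ → E} {g : ℂ → F}
    (hf : ∀ i, ContinuousOn (f i) (ball 0 1)) (hg : ContinuousOn g (ball 0 1))
    (hbound : ∀ i, ∃ C : ℝ, ∀ r ∈ Ico (0 : ℝ) 1,
      (∫ t in Ioc (0 : ℝ) (2 * π), ‖f i ((r : ℂ) * Complex.exp (t * Complex.I))‖ ^ 2) ≤ C)
    {A B : ℝ} (hB : 0 ≤ B)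
    (hle : ∀ z ∈ ball (0 : ℂ) 1, ‖g z‖ ^ 2 ≤ A + B * ∑ i, ‖f i z‖ ^ 2) :
    ∃ C : ℝ, ∀ r ∈ Ico (0 : ℝ) 1,
      (∫ t in Ioc (0 : ℝ) (2 * π), ‖g ((r : ℂ) * Complex.exp (t * Complex.I))‖ ^ 2) ≤ C := by
  choose K hK using hbound
  simp only [← circleMap_zero, ← intervalIntegral.integral_of_le two_pi_pos.le] at hK ⊢
  refine ⟨2 * π * A + B * ∑ i, K i, fun r hr => ?_⟩
  have hfc : ∀ i, Continuous fun t => ‖f i (circleMap 0 r t)‖ ^ 2 := fun i =>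
    ((hf i).continuous_comp_circleMap hr.1 hr.2).norm.pow 2
  have hgc := (hg.continuous_comp_circleMap hr.1 hr.2).norm.pow 2
  have hsum : Continuous fun t => ∑ i, ‖f i (circleMap 0 r t)‖ ^ 2 :=
    continuous_finsetSum _ fun i _ => hfc i
  calc ∫ t in 0..2 * π, ‖g (circleMap 0 r t)‖ ^ 2
      ≤ ∫ t in 0..2 * π, (A + B * ∑ i, ‖f i (circleMap 0 r t)‖ ^ 2) :=
        intervalIntegral.integral_mono_on two_pi_pos.le (hgc.intervalIntegrable _ _)
          ((continuous_const.add (hsum.const_mul B)).intervalIntegrable _ _)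
          fun t _ => hle _ (circleMap_mem_unit_ball hr.1 hr.2 t)
    _ = 2 * π * A + B * ∑ i, ∫ t in 0..2 * π, ‖f i (circleMap 0 r t)‖ ^ 2 := by
        rw [intervalIntegral.integral_add intervalIntegrable_const
          ((hsum.const_mul B).intervalIntegrable _ _), intervalIntegral.integral_const_mul,
          intervalIntegral.integral_finsetSum fun i _ => (hfc i).intervalIntegrable _ _]
        simp
    _ ≤ _ := by
        gcongr with i _
        exact hK i r hr

theorem MemH2V.sum_smul {n : ℕ} {ι : Type*} [Fintype ι] {f : ι → ℂ → (Fin n → ℂ)}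
    (hf : ∀ i, MemH2V n (f i)) (c : ι → ℂ) : MemH2V n fun z => ∑ i, c i • f i z := by
  have hd : DifferentiableOn ℂ (fun z => ∑ i, c i • f i z) (ball 0 1) :=
    DifferentiableOn.fun_sum fun i _ => (hf i).1.const_smul (c i)
  refine ⟨hd, exists_integral_sq_norm_le (A := 0) (B := ∑ i, ‖c i‖ ^ 2)
    (fun i => (hf i).1.continuousOn) hd.continuousOn (fun i => (hf i).2) (by positivity) ?_⟩
  intro z _
  rw [zero_add]
  refine (pow_le_pow_left₀ (norm_nonneg _) (norm_sum_le _ _) 2).trans ?_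
  simp only [norm_smul]
  exact Finset.sum_mul_sq_le_sq_mul_sq _ _ _

theorem memH2V_single_pow {n : ℕ} (j : Fin n) (m : ℕ) :
    MemH2V n fun z => Pi.single j (z ^ m) := by
  have hd : DifferentiableOn ℂ (fun z : ℂ => (Pi.single j (z ^ m) : Fin n → ℂ)) (ball 0 1) := by
    refine differentiableOn_pi.2 fun i => ?_
    by_cases h : i = j
    · subst h
      simpa using by fun_prop
    · simp [Pi.single_eq_of_ne h]
  refine ⟨hd, exists_integral_sq_norm_le (ι := Empty) (E := ℂ) (f := fun _ _ => 0) (A := 1)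
    (B := 0) (fun i => i.elim) hd.continuousOn (fun i => i.elim) le_rfl fun z hz => ?_⟩
  have hz1 : ‖z‖ < 1 := by simpa using hz
  rw [zero_mul, add_zero, Pi.norm_single, norm_pow, ← pow_mul]
  exact pow_le_one₀ (norm_nonneg z) hz1.le

theorem MemH2S.blaschkeQuotient {f : ℂ → ℂ} (hf : MemH2S f) {a : ℂ} (ha : ‖a‖ < 1) :
    MemH2S (blaschkeQuotient f a) := by
  have hd := differentiableOn_blaschkeQuotient hf.1 ha
  obtain ⟨C, hC0, hC⟩ := exists_norm_blaschkeQuotient_le hf.1 ha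
  refine ⟨hd, exists_integral_sq_norm_le (ι := Unit) (f := fun _ => f) (A := 2 * C ^ 2)
    (B := 2 * C ^ 2) (fun _ => hf.1.continuousOn) hd.continuousOn (fun _ => hf.2)
    (by positivity) fun z hz => ?_⟩
  have h := pow_le_pow_left₀ (norm_nonneg _) (hC z hz) 2
  simp only [Finset.univ_unique, Finset.sum_const, Finset.card_singleton, one_smul]
  nlinarith [mul_nonneg (sq_nonneg C) (sq_nonneg (1 - ‖f z‖))]

theorem MemH2S.const_mul {f : ℂ → ℂ} (hf : MemH2S f) (c : ℂ) : MemH2S fun z => c * f z := by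
  have hd : DifferentiableOn ℂ (fun z => c * f z) (ball 0 1) := hf.1.const_mul c
  refine ⟨hd, exists_integral_sq_norm_le (ι := Unit) (f := fun _ => f) (A := 0)
    (B := ‖c‖ ^ 2) (fun _ => hf.1.continuousOn) hd.continuousOn (fun _ => hf.2)
    (by positivity) fun z _ => ?_⟩
  simp [mul_pow]

theorem MemH2S.exists_eq_sum_add_blaschke_mul {D : ℕ} {a : Fin D → ℂ} (ha : ∀ j, ‖a j‖ < 1) :
    ∃ q : Fin D → (ℂ → ℂ), ∀ f : ℂ → ℂ, MemH2S f →
      ∃ (c : Fin D → ℂ) (h : ℂ → ℂ), MemH2S h ∧ ∀ z ∈ ball (0 : ℂ) 1,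
        f z = (∑ i, c i * q i z)
          + (∏ j, (z - a j) / (1 - (starRingEnd ℂ) (a j) * z)) * h z := by
  induction D with
  | zero => exact ⟨Fin.elim0, fun f hf => ⟨Fin.elim0, f, hf, by simp⟩⟩
  | succ D ih =>
    obtain ⟨q, hq⟩ := ih (a := fun j => a j.castSucc) fun j => ha _
    refine ⟨Fin.snoc q fun z =>
      ∏ j : Fin D, (z - a j.castSucc) / (1 - (starRingEnd ℂ) (a j.castSucc) * z),
      fun f hf => ?_⟩
    obtain ⟨c, h, hh, heq⟩ := hq f hf
    refine ⟨Fin.snoc c (h (a (Fin.last D))), _root_.blaschkeQuotient h (a (Fin.last D)),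
      hh.blaschkeQuotient (ha _), fun z hz => ?_⟩
    have hb := blaschke_mul_blaschkeQuotient h (ha (Fin.last D)) (by simpa using hz : ‖z‖ < 1)
    rw [Fin.sum_univ_castSucc, Fin.prod_univ_castSucc, mul_assoc, hb, heq z hz]
    simp only [Fin.snoc_castSucc, Fin.snoc_last]
    ring

theorem exists_polynomial_single_eq_mulVec {n : ℕ} {Θ : ℂ → Matrix (Fin n) (Fin n) ℂ}
    (hcodim : ∃ (k : ℕ) (q : Fin k → (ℂ → (Fin n → ℂ))),
      ∀ f : ℂ → (Fin n → ℂ), MemH2V n f →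
        ∃ (c : Fin k → ℂ) (h : ℂ → (Fin n → ℂ)), MemH2V n h ∧
          ∀ z ∈ ball (0 : ℂ) 1, f z = (∑ i, c i • q i z) + (Θ z).mulVec (h z))
    (j : Fin n) :
    ∃ (p : Polynomial ℂ) (H : ℂ → (Fin n → ℂ)), p ≠ 0 ∧ MemH2V n H ∧
      ∀ z ∈ ball (0 : ℂ) 1, Pi.single j (p.eval z) = (Θ z).mulVec (H z) := by
  obtain ⟨k, q, hq⟩ := hcodim
  choose c h hh heq using fun m : Fin (k + 1) => hq _ (memH2V_single_pow j m)
  have hdep : ¬ LinearIndependent ℂ c := fun hli => by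
    have := hli.fintype_card_le_finrank
    simp at this
  obtain ⟨l, hl, i, hi⟩ := Fintype.not_linearIndependent_iff.1 hdep
  refine ⟨∑ m : Fin (k + 1), Polynomial.monomial m (l m), fun z => ∑ m, l m • h m z, ?_,
    MemH2V.sum_smul hh l, fun z hz => ?_⟩
  · intro h0
    have := congrArg (fun p => Polynomial.coeff p i) h0
    exact hi (by simpa [Polynomial.coeff_monomial, Fin.val_inj] using this)
  · have h1 : (Pi.single j ((∑ m : Fin (k + 1), Polynomial.monomial m (l m)).eval z) : Fin n → ℂ)
        = ∑ m : Fin (k + 1), l m • Pi.single j (z ^ (m : ℕ)) := by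
      simp only [Polynomial.eval_finsetSum, Polynomial.eval_monomial, ← Pi.single_smul,
        smul_eq_mul]
      exact map_sum (AddMonoidHom.single (fun _ : Fin n => ℂ) j) _ _
    have h2 : ∑ m, l m • ∑ i, c m i • q i z = 0 := by
      simp only [Finset.smul_sum, smul_smul]
      rw [Finset.sum_comm]
      refine Finset.sum_eq_zero fun i _ => ?_
      rw [← Finset.sum_smul]
      have := congrFun hl i
      simp only [Finset.sum_apply, Pi.smul_apply, smul_eq_mul, Pi.zero_apply] at this
      rw [this, zero_smul]
    rw [h1]
    simp only [heq _ z hz, smul_add, Finset.sum_add_distrib, h2, zero_add, ← Matrix.mulVec_smul]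
    exact (Matrix.mulVec_sum _ _ _).symm

theorem Matrix.norm_det_le {n : ℕ} {A : Matrix (Fin n) (Fin n) ℂ} {x : ℝ}
    (h : ∀ i j, ‖A i j‖ ≤ x) : ‖A.det‖ ≤ n.factorial * x ^ n := by
  have := Matrix.det_le (abv := NormedField.toAbsoluteValue ℂ) (A := A) (x := x) h
  rwa [Fintype.card_fin, nsmul_eq_mul] at this

theorem radialInner_det {n : ℕ} {Θ : ℂ → Matrix (Fin n) (Fin n) ℂ}
    (hdiff : ∀ i j, DifferentiableOn ℂ (fun z => Θ z i j) (ball (0 : ℂ) 1))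
    (hbdd : ∀ i j, ∃ C : ℝ, ∀ z ∈ ball (0 : ℂ) 1, ‖Θ z i j‖ ≤ C)
    {Θb : ℝ → Matrix (Fin n) (Fin n) ℂ}
    (hbdry : ∀ᵐ t : ℝ, Tendsto (fun r : ℝ => Θ ((r : ℂ) * Complex.exp (t * Complex.I)))
        (nhdsWithin 1 (Iio 1)) (nhds (Θb t)))
    (hinner : ∀ᵐ t : ℝ, Θb t ∈ Matrix.unitaryGroup (Fin n) ℂ) :
    RadialInner fun z => (Θ z).det where
  diff := by
    simp only [Matrix.det_apply']
    exact DifferentiableOn.fun_sum fun σ _ => (differentiableOn_const _).mul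
      (DifferentiableOn.fun_finsetProd fun i _ => hdiff _ _)
  bdd := by
    choose C hC using hbdd
    refine ⟨n.factorial * (∑ i, ∑ j, |C i j|) ^ n, fun z hz => ?_⟩
    refine Matrix.norm_det_le fun i j => ?_
    calc ‖Θ z i j‖ ≤ |C i j| := (hC i j z hz).trans (le_abs_self _)
      _ ≤ ∑ j, |C i j| :=
        Finset.single_le_sum (f := fun j => |C i j|) (fun _ _ => abs_nonneg _) (Finset.mem_univ j)
      _ ≤ ∑ i, ∑ j, |C i j| :=
        Finset.single_le_sum (f := fun i => ∑ j, |C i j|)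
          (fun _ _ => Finset.sum_nonneg fun _ _ => abs_nonneg _) (Finset.mem_univ i)
  radial := by
    filter_upwards [hbdry, hinner] with t ht hu
    have hdet : Continuous fun A : Matrix (Fin n) (Fin n) ℂ => A.det := continuous_id.matrix_det
    have h := ((hdet.tendsto (Θb t)).comp ht).norm
    have h1 : ‖(Θb t).det‖ = 1 := CStarRing.norm_of_mem_unitary (Matrix.det_of_mem_unitary hu)
    rw [h1] at h
    simpa only [Function.comp_def, circleMap_zero] using h

theorem exists_norm_eval_le_det {n : ℕ} {Θ : ℂ → Matrix (Fin n) (Fin n) ℂ}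
    {p : Fin n → Polynomial ℂ} {H : Fin n → ℂ → (Fin n → ℂ)}
    (hpH : ∀ j, ∀ z ∈ ball (0 : ℂ) 1, Pi.single j ((p j).eval z) = (Θ z).mulVec (H j z))
    (z : ℂ) (hz : z ∈ ball (0 : ℂ) 1) :
    ‖(∏ j, p j).eval z‖ ≤ n.factorial * ‖(Θ z).det‖ * (1 + ∑ j, ‖H j z‖ ^ 2) ^ n := by
  have hmul : Θ z * Matrix.of (fun i j => H j z i) = Matrix.diagonal fun j => (p j).eval z := by
    ext i j
    have := congrFun (hpH j z hz) i
    simp only [Matrix.mulVec, dotProduct, Pi.single_apply] at this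
    simp only [Matrix.mul_apply, Matrix.of_apply, ← this, Matrix.diagonal_apply]
    split_ifs with h
    · rw [h]
    · rfl
  have hdet := congrArg Matrix.det hmul
  rw [Matrix.det_mul, Matrix.det_diagonal] at hdet
  rw [Polynomial.eval_prod, ← hdet, norm_mul]
  have hb : ‖(Matrix.of fun i j => H j z i).det‖
      ≤ n.factorial * (1 + ∑ j, ‖H j z‖ ^ 2) ^ n := by
    refine Matrix.norm_det_le fun i j => ?_
    calc ‖H j z i‖ ≤ ‖H j z‖ := norm_le_pi_norm _ _
      _ ≤ 1 + ‖H j z‖ ^ 2 := by nlinarith [sq_nonneg (‖H j z‖ - 1), norm_nonneg (H j z)]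
      _ ≤ _ := by
        gcongr
        exact Finset.single_le_sum (f := fun j => ‖H j z‖ ^ 2) (fun _ _ => by positivity)
          (Finset.mem_univ j)
  calc _ ≤ ‖(Θ z).det‖ * (n.factorial * (1 + ∑ j, ‖H j z‖ ^ 2) ^ n) := by gcongr
    _ = _ := by ring

/-- let `Θ` be an inner function in `H^∞_{L(E)}(𝔻)` with `dim E = n < ∞` such
that `Θ·H²_E(𝔻)` has finite codimension in `H²_E(𝔻)`.  Then `det Θ` is a finite Blaschke
product; in particular `H²(𝔻)/(det Θ)H²(𝔻)` is finite-dimensional. -/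
theorem det_of_finite_codimension_inner_is_finite_blaschke
    (n : ℕ) (Θ : ℂ → Matrix (Fin n) (Fin n) ℂ)
    (hdiff : ∀ i j, DifferentiableOn ℂ (fun z => Θ z i j) (ball (0 : ℂ) 1))
    (hbdd : ∀ i j, ∃ C : ℝ, ∀ z ∈ ball (0 : ℂ) 1, ‖Θ z i j‖ ≤ C)
    (Θb : ℝ → Matrix (Fin n) (Fin n) ℂ)
    (hbdry : ∀ᵐ t : ℝ, Tendsto (fun r : ℝ => Θ ((r : ℂ) * Complex.exp (t * Complex.I)))
        (nhdsWithin 1 (Iio 1)) (nhds (Θb t)))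
    (hinner : ∀ᵐ t : ℝ, Θb t ∈ Matrix.unitaryGroup (Fin n) ℂ)
    -- `Θ H²_E` has finite codimension: finitely many elements of `H²_E` span a complement
    (hcodim : ∃ (k : ℕ) (q : Fin k → (ℂ → (Fin n → ℂ))),
      ∀ f : ℂ → (Fin n → ℂ), MemH2V n f →
        ∃ (c : Fin k → ℂ) (h : ℂ → (Fin n → ℂ)), MemH2V n h ∧
          ∀ z ∈ ball (0 : ℂ) 1, f z = (∑ i, c i • q i z) + (Θ z).mulVec (h z)) :
    -- `det Θ` is a finite Blaschke product on `𝔻` …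
    (∃ (D : ℕ) (a : Fin D → ℂ) (c : ℂ), ‖c‖ = 1 ∧ (∀ j, ‖a j‖ < 1) ∧
      ∀ z ∈ ball (0 : ℂ) 1,
        (Θ z).det = c * ∏ j, (z - a j) / (1 - (starRingEnd ℂ) (a j) * z)) ∧
    -- … in particular `(det Θ)H²` has finite codimension in `H²(𝔻)`
    (∃ (m : ℕ) (q : Fin m → (ℂ → ℂ)),
      ∀ f : ℂ → ℂ, MemH2S f →
        ∃ (c : Fin m → ℂ) (h : ℂ → ℂ), MemH2S h ∧
          ∀ z ∈ ball (0 : ℂ) 1, f z = (∑ i, c i * q i z) + (Θ z).det * h z) := by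
  choose p H hp hH hpH using exists_polynomial_single_eq_mulVec hcodim
  have hw : ContinuousOn (fun z => ∑ j, ‖H j z‖ ^ 2) (ball 0 1) :=
    continuousOn_finsetSum _ fun j _ => (hH j).1.continuousOn.norm.pow 2
  choose K hK using fun j => (hH j).2
  simp only [← circleMap_zero, ← intervalIntegral.integral_of_le two_pi_pos.le] at hK
  have hKw : ∀ r ∈ Ico (0 : ℝ) 1,
      ∫ t in 0..2 * π, ∑ j, ‖H j (circleMap 0 r t)‖ ^ 2 ≤ ∑ j, K j := by
    intro r hr
    have hHc : ∀ j, Continuous fun t => ‖H j (circleMap 0 r t)‖ ^ 2 := fun j =>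
      ((hH j).1.continuousOn.continuous_comp_circleMap hr.1 hr.2).norm.pow 2
    rw [intervalIntegral.integral_finsetSum fun j _ => (hHc j).intervalIntegrable _ _]
    exact Finset.sum_le_sum fun j _ => hK j r hr
  obtain ⟨D, a, c, hc, ha, hdet⟩ := (radialInner_det hdiff hbdd hbdry hinner).exists_blaschke hw
    (fun z => by positivity) hKw (Finset.prod_ne_zero_iff.2 fun j _ => hp j)
    (exists_norm_eval_le_det hpH)
  refine ⟨⟨D, a, c, hc, ha, hdet⟩, D, ?_⟩
  obtain ⟨q, hq⟩ := MemH2S.exists_eq_sum_add_blaschke_mul ha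
  refine ⟨q, fun f hf => ?_⟩
  obtain ⟨b, h, hh, heq⟩ := hq f hf
  have hc0 : c ≠ 0 := norm_ne_zero_iff.1 (by rw [hc]; exact one_ne_zero)
  refine ⟨b, fun z => c⁻¹ * h z, hh.const_mul _, fun z hz => ?_⟩
  rw [heq z hz, hdet z hz]
  field_simp
end
end

section
/- Let φ₁,…,φ_n be commuting functions in H^∞_{L(E)}(𝔻) such that each cross-commutator [T_{φ_i}^*, T_{φ_j}] (1 ≤ i,j ≤ n) is a compact operator on H²_E(𝔻). Then the boundary-value operators commute with adjoints pointwise: [L_{φ_i}^*, L_{φ_j}] = 0 on L²_E(𝕋); in particular each φ_i(e^{it}) is a normal operator for a.e. t and the family {φ_i(e^{it})} is commuting normal. -/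
open MeasureTheory Real Complex AddCircle ContinuousLinearMap

noncomputable section

instance : Fact (0 < 2 * π) := ⟨by positivity⟩

open Filter Topology

section Hilbert

variable {H : Type*} [NormedAddCommGroup H] [InnerProductSpace ℂ H]

lemma tendsto_zero_of_total {G : Type*} [CompleteSpace H] [NormedAddCommGroup G]
    [NormedSpace ℂ G] {s : Set H} (hs : ∀ f, (∀ g ∈ s, inner ℂ g f = 0) → f = 0)
    (T : ℕ → H →L[ℂ] G) {C : ℝ}
    (hC : ∀ n, ‖T n‖ ≤ C) (hT : ∀ f ∈ s, Tendsto (fun n => T n f) atTop (𝓝 0)) (f : H) :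
    Tendsto (fun n => T n f) atTop (𝓝 0) := by
  have hspan : ∀ g ∈ Submodule.span ℂ s, Tendsto (fun n => T n g) atTop (𝓝 0) := by
    intro g hg
    induction hg using Submodule.span_induction with
    | mem g hg => exact hT g hg
    | zero => simp
    | add g h _ _ hg hh => simpa using hg.add hh
    | smul c g _ hg => simpa using hg.const_smul c
  have htop : (Submodule.span ℂ s).topologicalClosure = ⊤ := by
    rw [Submodule.topologicalClosure_eq_top_iff, Submodule.eq_bot_iff]
    exact fun f hf => hs f fun g hg => hf g (Submodule.subset_span hg)
  have hC0 : 0 ≤ C := (norm_nonneg _).trans (hC 0)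
  rw [Metric.tendsto_atTop]
  intro ε hε
  have hf : f ∈ closure (Submodule.span ℂ s : Set H) := by
    rw [← Submodule.topologicalClosure_coe, htop]; trivial
  obtain ⟨g, hg, hfg⟩ := Metric.mem_closure_iff.1 hf (ε / (2 * (C + 1))) (by positivity)
  obtain ⟨N, hN⟩ := Metric.tendsto_atTop.1 (hspan g hg) (ε / 2) (by positivity)
  refine ⟨N, fun n hn => ?_⟩
  have h1 := hN n hn
  rw [dist_zero_right] at h1 ⊢
  have h2 : ‖T n (f - g)‖ ≤ C * (ε / (2 * (C + 1))) := by
    refine ((T n).le_of_opNorm_le (hC n) _).trans ?_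
    rw [dist_eq_norm] at hfg
    gcongr
  have h3 : C * (ε / (2 * (C + 1))) ≤ ε / 2 := by
    rw [mul_div_assoc', div_le_div_iff₀ (by positivity) (by positivity)]
    nlinarith
  calc ‖T n f‖ = ‖T n (f - g) + T n g‖ := by simp
    _ ≤ ‖T n (f - g)‖ + ‖T n g‖ := norm_add_le _ _
    _ < ε := by linarith

lemma IsCompactOperator.tendsto_zero_of_weakly_tendsto_zero [CompleteSpace H] {K : H →L[ℂ] H}
    (hK : IsCompactOperator K) {u : ℕ → H} {C : ℝ} (hu : ∀ n, ‖u n‖ ≤ C)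
    (hweak : ∀ g, Tendsto (fun n => inner ℂ g (u n)) atTop (𝓝 0)) :
    Tendsto (fun n => K (u n)) atTop (𝓝 0) := by
  obtain ⟨S, hS, hsub⟩ :=
    IsCompactOperator.image_closedBall_subset_compact (f := (K : H →ₗ[ℂ] H)) hK C
  refine hS.tendsto_nhds_of_unique_mapClusterPt
    (.of_forall fun n => hsub ⟨u n, by simpa using hu n, rfl⟩) fun y _ hy => ?_
  have hlim : Tendsto (fun n => inner ℂ y (K (u n))) atTop (𝓝 0) := by
    simpa only [adjoint_inner_left] using hweak (adjoint K y)
  have hcl : MapClusterPt (inner ℂ y y) atTop (fun n => inner ℂ y (K (u n))) :=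
    hy.continuousAt_comp (f := fun z => inner ℂ y z) (by fun_prop)
  exact inner_self_eq_zero.1 (eq_of_nhds_neBot (hcl.clusterPt.mono hlim).neBot)

/-- `T` agrees with `L` asymptotically along the sequence of operators `U`. -/
def AsymptoticAlong (U : ℕ → H →L[ℂ] H) (T L : H →L[ℂ] H) : Prop :=
  ∀ f, Tendsto (fun n => T (U n f) - U n (L f)) atTop (𝓝 0)

namespace AsymptoticAlong

variable {U : ℕ → H →L[ℂ] H} {T T' L L' : H →L[ℂ] H}

lemma of_commute (h : ∀ n f, T (U n f) = U n (T f)) : AsymptoticAlong U T T := fun f => by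
  simp [h]

lemma comp (h : AsymptoticAlong U T L) (h' : AsymptoticAlong U T' L') :
    AsymptoticAlong U (T ∘L T') (L ∘L L') := fun f => by
  have h1 : Tendsto (fun n => T (T' (U n f) - U n (L' f))) atTop (𝓝 0) := by
    simpa only [Function.comp_def, map_zero] using (T.continuous.tendsto 0).comp (h' f)
  simpa using h1.add (h (L' f))

lemma sub (h : AsymptoticAlong U T L) (h' : AsymptoticAlong U T' L') :
    AsymptoticAlong U (T - T') (L - L') := fun f => by
  simpa [sub_sub_sub_comm] using (h f).sub (h' f)

lemma of_total [CompleteSpace H] {s : Set H} (hs : ∀ f, (∀ g ∈ s, inner ℂ g f = 0) → f = 0)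
    (hU : ∀ n, ‖U n‖ ≤ 1) (h : ∀ f ∈ s, ∀ᶠ n in atTop, T (U n f) = U n (L f)) :
    AsymptoticAlong U T L := fun f => by
  refine tendsto_zero_of_total hs (fun n => T ∘L U n - U n ∘L L) (C := ‖T‖ + ‖L‖)
    (fun n => (norm_sub_le _ _).trans (add_le_add ?_ ?_)) (fun g hg => ?_) f
  · exact (opNorm_comp_le _ _).trans (mul_le_of_le_one_right (norm_nonneg _) (hU n))
  · exact (opNorm_comp_le _ _).trans (mul_le_of_le_one_left (norm_nonneg _) (hU n))
  · refine tendsto_const_nhds.congr' ((h g hg).mono fun n hn => ?_)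
    simp [hn]

lemma eq_zero_of_isometric (h : AsymptoticAlong U T L) (hU : ∀ n f, ‖U n f‖ = ‖f‖)
    (hT : ∀ f, Tendsto (fun n => T (U n f)) atTop (𝓝 0)) : L = 0 := by
  ext f
  have h1 : Tendsto (fun n => U n (L f)) atTop (𝓝 0) := by
    simpa using (hT f).sub (h f)
  have h2 : Tendsto (fun _ : ℕ => ‖L f‖) atTop (𝓝 0) := by
    simpa [hU] using h1.norm
  exact norm_eq_zero.1 (tendsto_nhds_unique tendsto_const_nhds h2)

end AsymptoticAlong

lemma adjoint_commute_of_isCompactOperator_compression [CompleteSpace H] {U : ℕ → H →L[ℂ] H}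
    {P A B : H →L[ℂ] H} (hU : ∀ n f, ‖U n f‖ = ‖f‖)
    (hweak : ∀ f g, Tendsto (fun n => inner ℂ g (U n f)) atTop (𝓝 0))
    (hP : adjoint P = P) (hPU : AsymptoticAlong U P (ContinuousLinearMap.id ℂ H))
    (hA : ∀ n f, adjoint A (U n f) = U n (adjoint A f)) (hB : ∀ n f, B (U n f) = U n (B f))
    (hK : IsCompactOperator ((adjoint (P ∘L A ∘L P)) ∘L (P ∘L B ∘L P)
      - (P ∘L B ∘L P) ∘L (adjoint (P ∘L A ∘L P)))) :
    adjoint A ∘L B = B ∘L adjoint A := by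
  have hTA := (hPU.comp (.of_commute hA)).comp hPU
  have hTB := hPU.comp ((AsymptoticAlong.of_commute hB).comp hPU)
  have hadj : adjoint (P ∘L A ∘L P) = (P ∘L adjoint A) ∘L P := by
    rw [adjoint_comp, adjoint_comp, hP]
  rw [hadj] at hK
  exact sub_eq_zero.1 (((hTA.comp hTB).sub (hTB.comp hTA)).eq_zero_of_isometric hU fun f =>
    hK.tendsto_zero_of_weakly_tendsto_zero (fun n => (hU n f).le) (hweak f))

end Hilbert

section Multiplication

variable {α E : Type*} [MeasurableSpace α] {μ : Measure α}
  [NormedAddCommGroup E] [InnerProductSpace ℂ E]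

lemma memLp_clm_apply {ψ : α → E →L[ℂ] E} (hψ : AEStronglyMeasurable ψ μ) {C : ℝ}
    (hC : ∀ᵐ x ∂μ, ‖ψ x‖ ≤ C) {f : α → E} (hf : MemLp f 2 μ) : MemLp (fun x => ψ x (f x)) 2 μ :=
  hf.of_le_mul (c := C)
    (isBoundedBilinearMap_apply.continuous.comp_aestronglyMeasurable
      (hψ.prodMk hf.aestronglyMeasurable))
    (hC.mono fun x hx => (ψ x).le_of_opNorm_le hx _)

/-- Multiplication by a bounded operator-valued function, as an operator on `L²`. -/
def mulLp (ψ : α → E →L[ℂ] E) (hψ : AEStronglyMeasurable ψ μ) (C : ℝ)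
    (hC : ∀ᵐ x ∂μ, ‖ψ x‖ ≤ C) : Lp E 2 μ →L[ℂ] Lp E 2 μ :=
  LinearMap.mkContinuous
    { toFun := fun f => (memLp_clm_apply hψ hC (Lp.memLp f)).toLp _
      map_add' := fun f g => by
        refine Lp.ext ?_
        filter_upwards [MemLp.coeFn_toLp (memLp_clm_apply hψ hC (Lp.memLp (f + g))),
          Lp.coeFn_add ((memLp_clm_apply hψ hC (Lp.memLp f)).toLp _)
            ((memLp_clm_apply hψ hC (Lp.memLp g)).toLp _),
          MemLp.coeFn_toLp (memLp_clm_apply hψ hC (Lp.memLp f)),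
          MemLp.coeFn_toLp (memLp_clm_apply hψ hC (Lp.memLp g)), Lp.coeFn_add f g]
          with x h1 h2 h3 h4 h5
        rw [h1, h2, Pi.add_apply, h3, h4, h5, Pi.add_apply, map_add]
      map_smul' := fun c f => by
        refine Lp.ext ?_
        filter_upwards [MemLp.coeFn_toLp (memLp_clm_apply hψ hC (Lp.memLp (c • f))),
          Lp.coeFn_smul c ((memLp_clm_apply hψ hC (Lp.memLp f)).toLp _),
          MemLp.coeFn_toLp (memLp_clm_apply hψ hC (Lp.memLp f)), Lp.coeFn_smul c f]
          with x h1 h2 h3 h5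
        simp [h1, h2, h3, h5] }
    C fun f => by
      refine Lp.norm_le_mul_norm_of_ae_le_mul ?_
      filter_upwards [hC, MemLp.coeFn_toLp (memLp_clm_apply hψ hC (Lp.memLp f))] with x hx h
      simpa [h] using (ψ x).le_of_opNorm_le hx _

lemma coeFn_mulLp {ψ : α → E →L[ℂ] E} (hψ : AEStronglyMeasurable ψ μ) {C : ℝ}
    (hC : ∀ᵐ x ∂μ, ‖ψ x‖ ≤ C) (f : Lp E 2 μ) :
    mulLp ψ hψ C hC f =ᵐ[μ] fun x => ψ x (f x) :=
  MemLp.coeFn_toLp (memLp_clm_apply hψ hC (Lp.memLp f))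

/-- The adjoint of multiplication by `ψ` is multiplication by the pointwise adjoint of `ψ`. -/
lemma coeFn_adjoint_of_coeFn [CompleteSpace E] {ψ : α → E →L[ℂ] E}
    (hψ : AEStronglyMeasurable ψ μ) {C : ℝ} (hC : ∀ᵐ x ∂μ, ‖ψ x‖ ≤ C)
    {L : Lp E 2 μ →L[ℂ] Lp E 2 μ} (hL : ∀ f, L f =ᵐ[μ] fun x => ψ x (f x)) (f : Lp E 2 μ) :
    adjoint L f =ᵐ[μ] fun x => adjoint (ψ x) (f x) := by
  have hψ' : AEStronglyMeasurable (fun x => adjoint (ψ x)) μ :=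
    (adjoint (𝕜 := ℂ) (E := E) (F := E)).continuous.comp_aestronglyMeasurable hψ
  have hC' : ∀ᵐ x ∂μ, ‖adjoint (ψ x)‖ ≤ C := by simpa using hC
  have h : adjoint L = mulLp _ hψ' C hC' := by
    refine ((eq_adjoint_iff _ _).2 fun u v => ?_).symm
    rw [L2.inner_def, L2.inner_def]
    refine integral_congr_ae ?_
    filter_upwards [hL v, coeFn_mulLp hψ' hC' u] with x h1 h2
    rw [h1, h2, adjoint_inner_left]
  rw [h]
  exact coeFn_mulLp hψ' hC' f

lemma ae_eq_zero_of_forall_ae_apply_eq_zero [CompleteSpace E] [IsFiniteMeasure μ]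
    {D : α → E →L[ℂ] E} (hD : AEStronglyMeasurable D μ) {C : ℝ} (hC : ∀ᵐ x ∂μ, ‖D x‖ ≤ C)
    (h : ∀ v, ∀ᵐ x ∂μ, D x v = 0) : ∀ᵐ x ∂μ, D x = 0 := by
  have hint : Integrable D μ := .of_bound hD C hC
  refine hint.ae_eq_zero_of_forall_setIntegral_eq_zero fun s hs _ => ?_
  ext v
  rw [ContinuousLinearMap.integral_apply hint.integrableOn]
  simpa using integral_eq_zero_of_ae (ae_restrict_of_ae (h v))

/-- If the multiplication operators by `ψ` and `χ` satisfy `A* B = B A*`, then so do the values of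
`ψ` and `χ` almost everywhere. -/
lemma ae_adjoint_commute_of_adjoint_commute [CompleteSpace E] [IsFiniteMeasure μ]
    {ψ χ : α → E →L[ℂ] E} (hψ : AEStronglyMeasurable ψ μ) (hχ : AEStronglyMeasurable χ μ)
    {C D : ℝ} (hC : ∀ᵐ x ∂μ, ‖ψ x‖ ≤ C) (hD : ∀ᵐ x ∂μ, ‖χ x‖ ≤ D)
    {A B : Lp E 2 μ →L[ℂ] Lp E 2 μ} (hA : ∀ f, A f =ᵐ[μ] fun x => ψ x (f x))
    (hB : ∀ f, B f =ᵐ[μ] fun x => χ x (f x)) (hAB : adjoint A ∘L B = B ∘L adjoint A) :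
    ∀ᵐ x ∂μ, adjoint (ψ x) ∘L χ x = χ x ∘L adjoint (ψ x) := by
  have hψ' : AEStronglyMeasurable (fun x => adjoint (ψ x)) μ :=
    (adjoint (𝕜 := ℂ) (E := E) (F := E)).continuous.comp_aestronglyMeasurable hψ
  have hmeas : AEStronglyMeasurable
      (fun x => adjoint (ψ x) ∘L χ x - χ x ∘L adjoint (ψ x)) μ :=
    ((compL ℂ E E E).aestronglyMeasurable_comp₂ hψ' hχ).sub
      ((compL ℂ E E E).aestronglyMeasurable_comp₂ hχ hψ')
  have hbdd : ∀ᵐ x ∂μ, ‖adjoint (ψ x) ∘L χ x - χ x ∘L adjoint (ψ x)‖ ≤ C * D + D * C := by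
    filter_upwards [hC, hD] with x hC hD
    have hC' : ‖adjoint (ψ x)‖ ≤ C := by simpa using hC
    have hC0 := (norm_nonneg _).trans hC
    have hD0 := (norm_nonneg _).trans hD
    refine (norm_sub_le _ _).trans (add_le_add ?_ ?_) <;>
      exact (opNorm_comp_le _ _).trans (by gcongr)
  refine (ae_eq_zero_of_forall_ae_apply_eq_zero hmeas hbdd fun v => ?_).mono
    fun x hx => sub_eq_zero.1 hx
  have hconst : adjoint A (B (Lp.const 2 μ v)) = B (adjoint A (Lp.const 2 μ v)) :=
    DFunLike.congr_fun hAB _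
  have hadj := coeFn_adjoint_of_coeFn hψ hC hA
  filter_upwards [hadj (B (Lp.const 2 μ v)), hB (Lp.const 2 μ v),
    hB (adjoint A (Lp.const 2 μ v)), hadj (Lp.const 2 μ v),
    Lp.coeFn_const (p := 2) (μ := μ) (c := v)] with x h1 h2 h3 h4 h5
  rw [hconst, h3, h4, h2, h5] at h1
  simpa [sub_eq_zero] using h1.symm

end Multiplication

section Modulation

variable {E : Type*} [NormedAddCommGroup E] [InnerProductSpace ℂ E]

local notation "μT" => (haarAddCircle : Measure (AddCircle (2 * π)))

/-- Multiplication by `e^{ikt}` on `L²_E(𝕋)`. -/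
def modulation (k : ℤ) : Lp E 2 μT →L[ℂ] Lp E 2 μT :=
  mulLp (fun x => fourier k x • ContinuousLinearMap.id ℂ E)
    ((fourier k).continuous.smul continuous_const).aestronglyMeasurable 1
    (.of_forall fun x => by
      rw [norm_smul, fourier_apply, Circle.norm_coe, one_mul]
      exact norm_id_le)

lemma coeFn_modulation (k : ℤ) (f : Lp E 2 μT) :
    modulation k f =ᵐ[μT] fun x => fourier k x • f x :=
  coeFn_mulLp _ _ f

lemma norm_modulation (k : ℤ) (f : Lp E 2 μT) : ‖modulation k f‖ = ‖f‖ := by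
  rw [Lp.norm_def, Lp.norm_def]
  congr 1
  refine eLpNorm_congr_norm_ae ?_
  filter_upwards [coeFn_modulation k f] with x hx
  rw [hx, norm_smul, fourier_apply, Circle.norm_coe, one_mul]

lemma opNorm_modulation_le (k : ℤ) : ‖(modulation k : Lp E 2 μT →L[ℂ] Lp E 2 μT)‖ ≤ 1 :=
  opNorm_le_bound _ zero_le_one fun f => by rw [norm_modulation, one_mul]

lemma fourierCoeff_modulation (k : ℤ) (f : Lp E 2 μT) (m : ℤ) :
    fourierCoeff (modulation k f) m = fourierCoeff f (m - k) := by
  rw [fourierCoeff_congr_ae (coeFn_modulation k f)]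
  simp only [fourierCoeff, smul_smul, ← fourier_add]
  ring_nf

lemma fourierCoeff_const [CompleteSpace E] (v : E) {m : ℤ} (hm : m ≠ 0) :
    fourierCoeff (Lp.const 2 μT v) m = 0 := by
  rw [fourierCoeff_congr_ae (Lp.coeFn_const (p := 2) (μ := μT) (c := v))]
  have h := congrFun (fourierCoeff_fourier (T := 2 * π) 0) m
  simp only [fourierCoeff, fourier_zero, smul_eq_mul, mul_one, Pi.single_apply, hm,
    if_false] at h
  simp only [fourierCoeff, Function.const_apply, integral_smul_const, h, zero_smul]

lemma inner_modulation_const [CompleteSpace E] (k : ℤ) (v : E) (f : Lp E 2 μT) :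
    inner ℂ (modulation k (Lp.const 2 μT v)) f = inner ℂ v (fourierCoeff f k) := by
  rw [fourierCoeff, ← integral_inner (((Lp.memLp f).integrable (by norm_num)).fourier_smul _),
    L2.inner_def]
  refine integral_congr_ae ?_
  filter_upwards [coeFn_modulation k (Lp.const 2 μT v),
    Lp.coeFn_const (p := 2) (μ := μT) (c := v)] with x h1 h2
  rw [h1, h2, Function.const_apply, inner_smul_left, inner_smul_right, fourier_neg]

lemma eq_zero_of_fourierCoeff_eq_zero [CompleteSpace E] {f : Lp E 2 μT}
    (hf : ∀ k, fourierCoeff f k = 0) : f = 0 := by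
  have hint : Integrable f μT := (Lp.memLp f).integrable (by norm_num)
  have hscalar : ∀ v : E, ∀ᵐ x ∂μT, inner ℂ v (f x) = 0 := by
    intro v
    have hmem : MemLp (fun x => inner ℂ v (f x)) 2 μT := (Lp.memLp f).const_inner v
    have h0 : hmem.toLp _ = 0 := by
      refine (fourierBasis (T := 2 * π)).repr.map_eq_zero_iff.1 ?_
      ext k
      rw [fourierBasis_repr, fourierCoeff_congr_ae hmem.coeFn_toLp]
      have := integral_inner (𝕜 := ℂ) (hint.fourier_smul (-k)) v
      simp only [inner_smul_right] at this
      simpa [fourierCoeff, -fourier_apply, this] using congrArg (fun z => inner ℂ v z) (hf k)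
    filter_upwards [hmem.coeFn_toLp, Lp.coeFn_zero ℂ 2 μT] with x h1 h2
    rw [← h1, h0, h2, Pi.zero_apply]
  refine (Lp.eq_zero_iff_ae_eq_zero).2
    (hint.ae_eq_zero_of_forall_setIntegral_eq_zero fun s _ _ => ?_)
  refine ext_inner_left ℂ fun v => ?_
  rw [← integral_inner (𝕜 := ℂ) hint.integrableOn, inner_zero_right]
  exact integral_eq_zero_of_ae (ae_restrict_of_ae (hscalar v))

lemma eq_zero_of_forall_inner_modulation_const_eq_zero [CompleteSpace E] (f : Lp E 2 μT)
    (hf : ∀ g ∈ Set.range (fun p : ℤ × E => modulation p.1 (Lp.const 2 μT p.2)),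
      inner ℂ g f = 0) : f = 0 :=
  eq_zero_of_fourierCoeff_eq_zero fun k => ext_inner_left ℂ fun v => by
    rw [← inner_modulation_const, inner_zero_right]
    exact hf _ ⟨(k, v), rfl⟩

lemma tendsto_inner_modulation_const_modulation [CompleteSpace E] (k : ℤ) (v : E)
    (f : Lp E 2 μT) :
    Tendsto (fun N : ℕ => inner ℂ (modulation k (Lp.const 2 μT v)) (modulation N f))
      atTop (𝓝 0) := by
  have h := tendsto_zero_of_total eq_zero_of_forall_inner_modulation_const_eq_zero
    (fun N : ℕ => innerSL ℂ (modulation k (Lp.const 2 μT v)) ∘L modulation N)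
    (C := ‖innerSL ℂ (modulation k (Lp.const 2 μT v))‖)
    (fun N => (opNorm_comp_le _ _).trans
      (mul_le_of_le_one_right (norm_nonneg _) (opNorm_modulation_le _))) ?_ f
  · exact h
  rintro _ ⟨q, rfl⟩
  refine tendsto_const_nhds.congr' ?_
  filter_upwards [eventually_gt_atTop (k - q.1).toNat] with N hN
  simp only [ContinuousLinearMap.comp_apply, innerSL_apply_apply, inner_modulation_const,
    fourierCoeff_modulation]
  rw [fourierCoeff_const _ (by omega), inner_zero_right]

lemma tendsto_inner_modulation [CompleteSpace E] (f g : Lp E 2 μT) :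
    Tendsto (fun N : ℕ => inner ℂ g (modulation N f)) atTop (𝓝 0) := by
  have hconj := tendsto_zero_of_total eq_zero_of_forall_inner_modulation_const_eq_zero
    (fun N : ℕ => innerSL ℂ (modulation N f)) (C := ‖f‖)
    (fun N => by rw [innerSL_apply_norm, norm_modulation]) ?_ g
  · simpa only [Function.comp_def, innerSL_apply_apply, inner_conj_symm, map_zero] using
      (Complex.continuous_conj.tendsto 0).comp hconj
  rintro _ ⟨p, rfl⟩
  simpa only [Function.comp_def, innerSL_apply_apply, inner_conj_symm, map_zero] using
    (Complex.continuous_conj.tendsto 0).comp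
      (tendsto_inner_modulation_const_modulation p.1 p.2 f)

lemma commute_modulation {ψ : AddCircle (2 * π) → E →L[ℂ] E} {L : Lp E 2 μT →L[ℂ] Lp E 2 μT}
    (hL : ∀ f, L f =ᵐ[μT] fun x => ψ x (f x)) (k : ℤ) (f : Lp E 2 μT) :
    L (modulation k f) = modulation k (L f) := by
  refine Lp.ext ?_
  filter_upwards [hL (modulation k f), coeFn_modulation k f, coeFn_modulation k (L f), hL f]
    with x h1 h2 h3 h4
  rw [h1, h2, h3, h4, map_smul]

variable {P : Lp E 2 μT →L[ℂ] Lp E 2 μT}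

lemma adjoint_szego_eq [CompleteSpace E]
    (hPmem : ∀ f, ∀ m : ℤ, m < 0 → fourierCoeff (⇑(P f)) m = 0)
    (hPorth : ∀ f g : Lp E 2 μT,
      (∀ m : ℤ, m < 0 → fourierCoeff (⇑g) m = 0) → inner (𝕜 := ℂ) (f - P f) g = 0) :
    adjoint P = P := by
  have h1 : ∀ f g, inner ℂ f (P g) = inner ℂ (P f) (P g) := fun f g => by
    simpa [inner_sub_left, sub_eq_zero] using hPorth f (P g) (hPmem g)
  refine ((eq_adjoint_iff _ _).2 fun u v => ?_).symm
  rw [h1, ← inner_conj_symm, h1, inner_conj_symm]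

lemma szego_eq_self
    (hPmem : ∀ f, ∀ m : ℤ, m < 0 → fourierCoeff (⇑(P f)) m = 0)
    (hPorth : ∀ f g : Lp E 2 μT,
      (∀ m : ℤ, m < 0 → fourierCoeff (⇑g) m = 0) → inner (𝕜 := ℂ) (f - P f) g = 0)
    {f : Lp E 2 μT} (hf : ∀ m : ℤ, m < 0 → fourierCoeff (⇑f) m = 0) : P f = f := by
  have h : inner ℂ (f - P f) (f - P f) = 0 := by
    rw [inner_sub_right, hPorth f f hf, hPorth f (P f) (hPmem f), sub_zero]
  exact (sub_eq_zero.1 (inner_self_eq_zero.1 h)).symm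

lemma asymptoticAlong_szego [CompleteSpace E]
    (hPmem : ∀ f, ∀ m : ℤ, m < 0 → fourierCoeff (⇑(P f)) m = 0)
    (hPorth : ∀ f g : Lp E 2 μT,
      (∀ m : ℤ, m < 0 → fourierCoeff (⇑g) m = 0) → inner (𝕜 := ℂ) (f - P f) g = 0) :
    AsymptoticAlong (fun N : ℕ => modulation N) P (ContinuousLinearMap.id ℂ _) := by
  refine .of_total eq_zero_of_forall_inner_modulation_const_eq_zero
    (fun N => opNorm_modulation_le N) ?_
  rintro _ ⟨p, rfl⟩
  filter_upwards [eventually_ge_atTop (-p.1).toNat] with N hN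
  refine szego_eq_self hPmem hPorth fun m hm => ?_
  rw [fourierCoeff_modulation]
  exact (fourierCoeff_modulation _ _ _).trans (fourierCoeff_const _ (by omega))

end Modulation

/-- let `φ₁, …, φ_n` be commuting functions in `H^∞_{L(E)}(𝔻)` (realized by their
boundary values: bounded measurable operator-valued functions with vanishing negative Fourier
coefficients, commuting pointwise a.e.), let `L_i` be the corresponding Laurent multiplication
operators on `L²_E(𝕋)` and `P` the Szegő projection onto `H²_E(𝔻)`, so that the Toeplitz
operator `T_{φ_i}` is (the compression) `P L_i P`.  If every cross-commutator
`[T_{φ_i}^*, T_{φ_j}]` is compact, then `[L_{φ_i}^*, L_{φ_j}] = 0` on `L²_E(𝕋)`; in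
particular a.e. the operators `φ_i(e^{it})` form a commuting family of normal operators. -/
theorem compact_cross_commutators_implies_normal_boundary_values
    (E : Type) [NormedAddCommGroup E] [InnerProductSpace ℂ E] [CompleteSpace E]
    (n : ℕ) (φ : Fin n → AddCircle (2 * π) → (E →L[ℂ] E))
    (hmeas : ∀ i, AEStronglyMeasurable (φ i) haarAddCircle)
    (hbdd : ∀ i, ∃ C : ℝ, ∀ᵐ x ∂(haarAddCircle : Measure (AddCircle (2 * π))), ‖φ i x‖ ≤ C)
    (hanal : ∀ i, ∀ m : ℤ, m < 0 → ∀ v : E, fourierCoeff (fun x => φ i x v) m = 0)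
    (hcomm : ∀ i j, ∀ᵐ x ∂(haarAddCircle : Measure (AddCircle (2 * π))),
      (φ i x) ∘L (φ j x) = (φ j x) ∘L (φ i x))
    (Lop : Fin n → Lp E 2 (haarAddCircle : Measure (AddCircle (2 * π)))
      →L[ℂ] Lp E 2 (haarAddCircle : Measure (AddCircle (2 * π))))
    (hLop : ∀ i f, ⇑(Lop i f) =ᵐ[haarAddCircle] fun x => φ i x (f x))
    (P : Lp E 2 (haarAddCircle : Measure (AddCircle (2 * π)))
      →L[ℂ] Lp E 2 (haarAddCircle : Measure (AddCircle (2 * π))))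
    (hPmem : ∀ f, ∀ m : ℤ, m < 0 → fourierCoeff (⇑(P f)) m = 0)
    (hPorth : ∀ f g : Lp E 2 (haarAddCircle : Measure (AddCircle (2 * π))),
      (∀ m : ℤ, m < 0 → fourierCoeff (⇑g) m = 0) →
      inner (𝕜 := ℂ) (f - P f) g = 0)
    (hcpt : ∀ i j, IsCompactOperator
      ((adjoint (P ∘L Lop i ∘L P)) ∘L (P ∘L Lop j ∘L P)
        - (P ∘L Lop j ∘L P) ∘L (adjoint (P ∘L Lop i ∘L P)))) :
    (∀ i j, (adjoint (Lop i)) ∘L (Lop j) = (Lop j) ∘L (adjoint (Lop i))) ∧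
    (∀ i j, ∀ᵐ x ∂(haarAddCircle : Measure (AddCircle (2 * π))),
      (adjoint (φ i x)) ∘L (φ j x) = (φ j x) ∘L (adjoint (φ i x))) := by
  have hcomm_adj : ∀ i j, adjoint (Lop i) ∘L Lop j = Lop j ∘L adjoint (Lop i) := by
    intro i j
    obtain ⟨C, hC⟩ := hbdd i
    exact adjoint_commute_of_isCompactOperator_compression (fun N f => norm_modulation N f)
      tendsto_inner_modulation (adjoint_szego_eq hPmem hPorth)
      (asymptoticAlong_szego hPmem hPorth)
      (fun N f => commute_modulation (coeFn_adjoint_of_coeFn (hmeas i) hC (hLop i)) N f)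
      (fun N f => commute_modulation (hLop j) N f) (hcpt i j)
  refine ⟨hcomm_adj, fun i j => ?_⟩
  obtain ⟨Ci, hCi⟩ := hbdd i
  obtain ⟨Cj, hCj⟩ := hbdd j
  exact ae_adjoint_commute_of_adjoint_commute (hmeas i) (hmeas j) hCi hCj (hLop i) (hLop j)
    (hcomm_adj i j)
end
end

section
/- Let A be a contraction on a finite-dimensional Hilbert space whose spectrum is contained in the boundary ∂Ω of a bounded domain Ω ⊂ ℂ, and suppose the closure of Ω is a spectral set for A. If ∂Ω is a finite union of smooth simple closed curves, then A is a normal operator. -/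
open Polynomial Set
open Topology Filter MeasureTheory

/-- If `‖B‖ ≤ ‖μ‖` and `B x = μ x`, then `x` is also an eigenvector of the adjoint of `B`. -/
theorem adjoint_apply_eq_of_norm_le {E : Type*} [NormedAddCommGroup E] [InnerProductSpace ℂ E]
    [CompleteSpace E] {B : E →L[ℂ] E} {μ : ℂ} {x : E} (hB : ‖B‖ ≤ ‖μ‖) (hx : B x = μ • x) :
    B.adjoint x = (starRingEnd ℂ μ) • x := by
  have h1 : ‖B.adjoint x‖ ≤ ‖μ‖ * ‖x‖ := by
    refine (B.adjoint.le_opNorm x).trans ?_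
    rw [LinearIsometryEquiv.norm_map]
    gcongr
  have h2 : ‖B.adjoint x - (starRingEnd ℂ μ) • x‖ ^ 2 ≤ 0 := by
    rw [@norm_sub_sq ℂ, inner_smul_right, ContinuousLinearMap.adjoint_inner_left, hx,
      inner_smul_right, inner_self_eq_norm_sq_to_K, norm_smul, RCLike.norm_conj, ← mul_assoc,
      RCLike.conj_mul]
    have : RCLike.re (((‖μ‖ : ℂ) ^ 2) * ((‖x‖ : ℂ) ^ 2)) = ‖μ‖ ^ 2 * ‖x‖ ^ 2 := by
      norm_cast
    have h3 := pow_le_pow_left₀ (norm_nonneg _) h1 2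
    erw [this]
    nlinarith
  have h3 : ‖B.adjoint x - (starRingEnd ℂ μ) • x‖ = 0 := by
    nlinarith [norm_nonneg (B.adjoint x - (starRingEnd ℂ μ) • x)]
  exact sub_eq_zero.1 (norm_eq_zero.1 h3)

/-- An operator on a finite-dimensional space all of whose eigenvectors are eigenvectors of the
adjoint, with conjugate eigenvalue, is normal. -/
theorem isStarNormal_of_adjoint_apply_eigenvector {E : Type*} [NormedAddCommGroup E]
    [InnerProductSpace ℂ E] [FiniteDimensional ℂ E] {A : E →L[ℂ] E}
    (h : ∀ (μ : ℂ) (x : E), A x = μ • x → star A x = (starRingEnd ℂ μ) • x) :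
    IsStarNormal A := by
  set S : Submodule ℂ E := ⨆ μ : ℂ, Module.End.eigenspace (A : E →ₗ[ℂ] E) μ with hS
  have hinv : ∀ y ∈ Sᗮ, (A : E →ₗ[ℂ] E) y ∈ Sᗮ := by
    intro y hy
    rw [hS, ← Submodule.iInf_orthogonal, Submodule.mem_iInf] at hy ⊢
    intro μ x hx
    have hx' : A x = μ • x := Module.End.mem_eigenspace_iff.1 hx
    rw [ContinuousLinearMap.coe_coe, ← ContinuousLinearMap.adjoint_inner_left,
      ← ContinuousLinearMap.star_eq_adjoint, h μ x hx', inner_smul_left, hy μ x hx, mul_zero]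
  have hbot : Sᗮ = ⊥ := by
    by_contra hne
    have : Nontrivial Sᗮ := Submodule.nontrivial_iff_ne_bot.2 hne
    obtain ⟨μ, hμ⟩ := Module.End.exists_eigenvalue ((A : E →ₗ[ℂ] E).restrict hinv)
    obtain ⟨x, hx⟩ := hμ.exists_hasEigenvector
    have h1 : A (x : E) = μ • (x : E) := congrArg Subtype.val hx.apply_eq_smul
    have h2 : (x : E) ∈ S :=
      Submodule.mem_iSup_of_mem μ (Module.End.mem_eigenspace_iff.2 h1)
    have h3 : (x : E) = 0 := inner_self_eq_zero (𝕜 := ℂ) |>.1 (x.2 _ h2)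
    exact hx.2 (Subtype.ext h3)
  have htop : S = ⊤ := Submodule.orthogonal_eq_bot_iff.1 hbot
  refine ⟨ContinuousLinearMap.ext fun x => ?_⟩
  have hxS : x ∈ S := htop ▸ Submodule.mem_top
  refine Submodule.iSup_induction _ (motive := fun x => (star A * A) x = (A * star A) x) hxS
    ?_ (by simp) (fun x y hx hy => by rw [map_add, map_add, hx, hy])
  intro μ x hx
  have hx' : A x = μ • x := Module.End.mem_eigenspace_iff.1 hx
  simp only [mul_apply_eq_comp, hx', h μ x hx', map_smul, smul_comm μ]

/-- If the exterior of the spectral set `closure Ω` contains a disc touching it at `μ`, then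
every eigenvector for `μ` is an eigenvector of the adjoint. -/
theorem adjoint_apply_eigenvector_of_exterior_disc
    {E : Type*} [NormedAddCommGroup E] [InnerProductSpace ℂ E] [FiniteDimensional ℂ E]
    {A : E →L[ℂ] E} {Ω : Set ℂ} (hspec : spectrum ℂ A ⊆ frontier Ω)
    (hspectralSet : ∀ p q : Polynomial ℂ, (∀ z ∈ closure Ω, q.eval z ≠ 0) →
      ∀ B : E →L[ℂ] E,
        (aeval A q) * B = 1 → B * (aeval A q) = 1 →
        ∀ M : ℝ, (∀ z ∈ closure Ω, ‖p.eval z / q.eval z‖ ≤ M) → ‖(aeval A p) * B‖ ≤ M)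
    {μ c : ℂ} (hc : c ≠ μ) (hdisc : Disjoint (Metric.ball c ‖μ - c‖) Ω)
    {x : E} (hx : A x = μ • x) : star A x = (starRingEnd ℂ μ) • x := by
  have hsub : μ - c ≠ 0 := sub_ne_zero.2 hc.symm
  have hpos : 0 < ‖μ - c‖ := norm_pos_iff.2 hsub
  have hfar : ∀ z ∈ closure Ω, ‖μ - c‖ ≤ ‖z - c‖ := by
    intro z hz
    by_contra! hlt
    exact (hdisc.closure_right Metric.isOpen_ball).le_bot
      ⟨mem_ball_iff_norm.2 hlt, hz⟩
  have hcΩ : c ∉ closure Ω := fun hmem => by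
    have := hfar c hmem
    simp only [sub_self, norm_zero] at this
    linarith
  have hcA : c ∉ spectrum ℂ A := fun hmem => hcΩ (frontier_subset_closure (hspec hmem))
  have hunit : IsUnit (A - algebraMap ℂ (E →L[ℂ] E) c) := by
    rw [← neg_sub]
    exact (spectrum.notMem_iff.1 hcA).neg
  obtain ⟨u, hu⟩ := hunit
  set B : E →L[ℂ] E := ↑u⁻¹ with hBdef
  have hq : aeval A (X - C c : Polynomial ℂ) = ↑u := by simp [hu]
  have hB : ‖B‖ ≤ ‖(μ - c)⁻¹‖ := by
    have := hspectralSet 1 (X - C c) (fun z hz h0 => by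
        have h1 := hfar z hz
        simp only [eval_sub, eval_X, eval_C] at h0
        rw [h0, norm_zero] at h1
        linarith) B (by rw [hq]; exact u.mul_inv) (by rw [hq]; exact u.inv_mul)
        ‖(μ - c)⁻¹‖ (fun z hz => by
          simp only [eval_one, eval_sub, eval_X, eval_C, one_div, norm_inv]
          exact inv_anti₀ hpos (hfar z hz))
    simpa using this
  have hux : (u : E →L[ℂ] E) x = (μ - c) • x := by
    rw [hu, sub_apply, hx, sub_smul, Algebra.algebraMap_eq_smul_one]
    simp
  have hBx : B x = (μ - c)⁻¹ • x := by
    have h1 : B ((u : E →L[ℂ] E) x) = x := by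
      rw [← mul_apply_eq_comp, hBdef, u.inv_mul]; simp
    rw [hux, map_smul] at h1
    rw [eq_inv_smul_iff₀ hsub, h1]
  have hadj := adjoint_apply_eq_of_norm_le hB hBx
  have h2 : star (u : E →L[ℂ] E) (star B x) = x := by
    rw [← mul_apply_eq_comp, ← star_mul, hBdef, u.inv_mul]; simp
  rw [ContinuousLinearMap.star_eq_adjoint B, hadj, map_smul, map_inv₀,
    inv_smul_eq_iff₀ ((_root_.map_ne_zero _).2 hsub), hu, star_sub, sub_apply,
    sub_eq_iff_eq_add] at h2
  rw [h2, Algebra.algebraMap_eq_smul_one, star_smul, star_one, map_sub, sub_smul]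
  simp
/-- The (unnormalised) winding integral of a closed curve is locally constant off the curve. -/
theorem hasDerivAt_windingIntegral {γ : ℝ → ℂ} (hγ : ContDiff ℝ 1 γ) {a b : ℝ} (hab : γ a = γ b)
    (hle : a ≤ b) {z : ℂ} (hz : ∀ t ∈ Icc a b, γ t ≠ z) :
    HasDerivAt (fun w => ∫ t in a..b, deriv γ t / (γ t - w)) 0 z := by
  have hcont : Continuous γ := hγ.continuous
  have hcont' : Continuous (deriv γ) := hγ.continuous_deriv le_rfl
  obtain ⟨d, hd, hdz⟩ : ∃ d > 0, ∀ t ∈ Icc a b, d ≤ ‖γ t - z‖ := by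
    obtain ⟨t₀, ht₀, hmin⟩ := isCompact_Icc.exists_isMinOn (nonempty_Icc.2 hle)
      (f := fun t => ‖γ t - z‖) (by fun_prop)
    exact ⟨_, norm_pos_iff.2 (sub_ne_zero.2 (hz t₀ ht₀)), fun t ht => hmin ht⟩
  have hne : ∀ t ∈ Icc a b, γ t - z ≠ 0 := fun t ht => sub_ne_zero.2 (hz t ht)
  refine (hasDerivAt_const z (∫ t in a..b, deriv γ t / (γ t - z))).congr_of_eventuallyEq ?_
  filter_upwards [Metric.ball_mem_nhds z hd] with w hw
  rw [mem_ball_iff_norm] at hw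
  have hnew : ∀ t ∈ Icc a b, γ t - w ≠ 0 := fun t ht h0 => by
    have h1 := hdz t ht
    rw [sub_eq_zero.1 h0] at h1
    linarith
  have hslit : ∀ t ∈ Icc a b, (γ t - w) / (γ t - z) ∈ Complex.slitPlane := by
    intro t ht
    have h1 : (γ t - w) / (γ t - z) = 1 + -((w - z) / (γ t - z)) := by
      field_simp [hne t ht]
      ring
    rw [h1]
    apply Complex.mem_slitPlane_of_norm_lt_one
    rw [norm_neg, norm_div, div_lt_one (hd.trans_le (hdz t ht))]
    exact hw.trans_le (hdz t ht)
  rw [← sub_eq_zero]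
  have hint : ∀ w, (∀ t ∈ Icc a b, γ t - w ≠ 0) →
      IntervalIntegrable (fun t => deriv γ t / (γ t - w)) volume a b := fun w hw =>
    ContinuousOn.intervalIntegrable (by
      rw [uIcc_of_le hle]
      exact hcont'.continuousOn.div (by fun_prop) hw)
  rw [← intervalIntegral.integral_sub (hint w hnew) (hint z hne)]
  have hderiv : ∀ t ∈ uIcc a b, HasDerivAt (fun t => Complex.log ((γ t - w) / (γ t - z)))
      (deriv γ t / (γ t - w) - deriv γ t / (γ t - z)) t := by
    intro t ht
    rw [uIcc_of_le hle] at ht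
    have h0 : HasDerivAt γ (deriv γ t) t := (hγ.differentiable one_ne_zero t).hasDerivAt
    have h1 : HasDerivAt (fun t => (γ t - w) / (γ t - z))
        ((deriv γ t * (γ t - z) - (γ t - w) * deriv γ t) / (γ t - z) ^ 2) t :=
      (h0.sub_const w).div (h0.sub_const z) (hne t ht)
    convert h1.clog_real (hslit t ht) using 1
    have := hne t ht
    have := hnew t ht
    field_simp
  rw [intervalIntegral.integral_eq_sub_of_hasDerivAt hderiv ((hint w hnew).sub (hint z hne)), hab,
    sub_self]

/-- Taylor bounds at `0` for a `C²` curve with `u 0 = 0` and `u' 0 = 1`. -/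
theorem exists_taylor_bounds {u : ℝ → ℂ} (hu : ContDiff ℝ 2 u) (h0 : u 0 = 0)
    (h1 : deriv u 0 = 1) (r : ℝ) :
    ∃ C > 0, ∀ t ∈ Icc (-r) r, ‖deriv u t - 1‖ ≤ C * |t| ∧ ‖u t - t‖ ≤ C * t ^ 2 := by
  have hu' : ContDiff ℝ 1 (deriv u) := by
    rw [← one_add_one_eq_two] at hu
    exact (contDiff_succ_iff_deriv.1 hu).2.2
  obtain ⟨C, hC⟩ := (isCompact_Icc (a := -r) (b := r)).exists_bound_of_continuousOn
    (hu'.continuous_deriv le_rfl).continuousOn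
  have hd : ∀ t ∈ Icc (-r) r, ‖deriv u t - 1‖ ≤ max C 1 * |t| := by
    intro t ht
    have h0m : (0 : ℝ) ∈ Icc (-r) r := by constructor <;> linarith [ht.1, ht.2]
    have := (convex_Icc (-r) r).norm_image_sub_le_of_norm_deriv_le (f := deriv u)
      (fun x _ => hu'.differentiable one_ne_zero x)
      (fun x hx => (hC x hx).trans (le_max_left C 1)) h0m ht
    simpa [h1] using this
  refine ⟨max C 1, by positivity, fun t ht => ⟨hd t ht, ?_⟩⟩
  have hsub : ∀ x ∈ uIcc 0 t, x ∈ Icc (-r) r ∧ |x| ≤ |t| := by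
    intro x hx
    rcases le_total 0 t with h | h
    · rw [uIcc_of_le h] at hx
      rw [abs_of_nonneg h, abs_of_nonneg hx.1]
      exact ⟨⟨by linarith [ht.2, hx.1, hx.2], by linarith [ht.2, hx.2]⟩, hx.2⟩
    · rw [uIcc_of_ge h] at hx
      rw [abs_of_nonpos h, abs_of_nonpos hx.2]
      exact ⟨⟨by linarith [ht.1, hx.1], by linarith [ht.1, hx.1, hx.2]⟩, by linarith [hx.1]⟩
  have hder : ∀ x, HasDerivAt (fun x : ℝ => u x - x) (deriv u x - 1) x := fun x =>
    (hu.differentiable two_ne_zero x).hasDerivAt.sub (Complex.ofRealCLM.hasDerivAt (x := x))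
  have := (convex_uIcc 0 t).norm_image_sub_le_of_norm_hasDerivWithin_le
    (fun x _ => (hder x).hasDerivWithinAt) (C := max C 1 * |t|)
    (fun x hx => (hd x (hsub x hx).1).trans 
      (mul_le_mul_of_nonneg_left (hsub x hx).2 (by positivity)))
    left_mem_uIcc right_mem_uIcc
  simp only [h0, Complex.ofReal_zero, sub_zero, Real.norm_eq_abs] at this
  rwa [mul_assoc, abs_mul_abs_self, ← sq] at this

/-- A `C²` curve vanishing only at `0`, with nonzero speed there, grows linearly. -/
theorem exists_mul_sq_le_norm_sq {u : ℝ → ℂ} (hu : ContDiff ℝ 2 u) (h0 : u 0 = 0)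
    (h1 : deriv u 0 = 1) {r : ℝ} (hr : 0 ≤ r) (hne : ∀ t ∈ Icc (-r) r, t ≠ 0 → u t ≠ 0) :
    ∃ c > 0, ∀ t ∈ Icc (-r) r, c * t ^ 2 ≤ ‖u t‖ ^ 2 := by
  have hd : Differentiable ℝ u := hu.differentiable two_ne_zero
  have hcont : Continuous (dslope u 0) := continuous_iff_continuousAt.2 fun t => by
    rcases eq_or_ne t 0 with rfl | ht
    · exact continuousAt_dslope_same.2 (hd 0)
    · exact (continuousAt_dslope_of_ne ht).2 hd.continuous.continuousAt
  have hnz : ∀ t ∈ Icc (-r) r, dslope u 0 t ≠ 0 := by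
    intro t ht
    rcases eq_or_ne t 0 with rfl | ht0
    · simp [h1]
    · rw [dslope_of_ne _ ht0, slope_def_module, h0, sub_zero, sub_zero]
      exact smul_ne_zero (inv_ne_zero ht0) (hne t ht ht0)
  obtain ⟨t₀, ht₀, hmin⟩ := (isCompact_Icc (a := -r) (b := r)).exists_isMinOn
    ⟨0, by simpa using hr⟩ (f := fun t => ‖dslope u 0 t‖ ^ 2) (by fun_prop)
  refine ⟨_, pow_pos (norm_pos_iff.2 (hnz t₀ ht₀)) 2, fun t ht => ?_⟩
  have h2 : u t = t • dslope u 0 t := by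
    have := sub_smul_dslope u 0 t
    rw [h0, sub_zero, sub_zero] at this
    exact this.symm
  have h3 : ‖dslope u 0 t₀‖ ^ 2 ≤ ‖dslope u 0 t‖ ^ 2 := hmin ht
  rw [h2, norm_smul, mul_pow, Real.norm_eq_abs, sq_abs, mul_comm]
  gcongr

/-- The points `s * I` with `s` small are quantitatively away from the curve `u`. -/
theorem exists_le_norm_sub_mul_I_sq {u : ℝ → ℂ} {r C c : ℝ} (hC : 0 < C) (hc : 0 < c)
    (hup : ∀ t ∈ Icc (-r) r, ‖u t - t‖ ≤ C * t ^ 2)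
    (hlow : ∀ t ∈ Icc (-r) r, c * t ^ 2 ≤ ‖u t‖ ^ 2) :
    ∃ ρ > 0, ∃ m > 0, m ≤ 1 ∧ ∀ s : ℝ, |s| ≤ ρ → ∀ t ∈ Icc (-r) r,
      m * t ^ 2 + s ^ 2 ≤ ‖u t - s * Complex.I‖ ^ 2 := by
  refine ⟨c / (4 * C), by positivity, min (c / 2) 1, by positivity, min_le_right _ _,
    fun s hs t ht => ?_⟩
  have him : |(u t).im| ≤ C * t ^ 2 := by
    have := (Complex.abs_im_le_norm (u t - t)).trans (hup t ht)
    simpa using this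
  have h1 : ‖u t - s * Complex.I‖ ^ 2 = ‖u t‖ ^ 2 - 2 * (s * (u t).im) + s ^ 2 := by
    rw [← Complex.normSq_eq_norm_sq, ← Complex.normSq_eq_norm_sq, Complex.normSq_apply,
      Complex.normSq_apply]
    simp
    ring
  have h2 : s * (u t).im ≤ c / 4 * t ^ 2 := by
    calc s * (u t).im ≤ |s| * |(u t).im| := by rw [← abs_mul]; exact le_abs_self _
      _ ≤ c / (4 * C) * (C * t ^ 2) := by gcongr
      _ = c / 4 * t ^ 2 := by field_simp
  have h3 : min (c / 2) 1 * t ^ 2 ≤ c / 2 * t ^ 2 := by gcongr; exact min_le_left _ _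
  rw [h1]
  linarith [hlow t ht]

theorem tendsto_integral_poisson {r : ℝ} (hr : 0 < r) :
    Tendsto (fun s : ℝ => ∫ t in (-r)..r, 2 * s / (t ^ 2 + s ^ 2)) (𝓝[>] 0)
      (𝓝 (2 * Real.pi)) := by
  have heq : ∀ s : ℝ, 0 < s →
      4 * Real.arctan (r * s⁻¹) = ∫ t in (-r)..r, 2 * s / (t ^ 2 + s ^ 2) := by
    intro s hs
    have hder : ∀ t ∈ uIcc (-r) r, HasDerivAt (fun t => 2 * Real.arctan (t / s))
        (2 * s / (t ^ 2 + s ^ 2)) t := by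
      intro t _
      refine ((((hasDerivAt_id' t).div_const s).arctan).const_mul 2).congr_deriv ?_
      have : 1 + (t / s) ^ 2 ≠ 0 := by positivity
      field_simp
      ring
    rw [intervalIntegral.integral_eq_sub_of_hasDerivAt hder
      (Continuous.intervalIntegrable (by
        refine Continuous.div (by fun_prop) (by fun_prop) fun t => ?_
        positivity) _ _), neg_div, Real.arctan_neg, div_eq_mul_inv]
    ring
  have h1 : Tendsto (fun s : ℝ => 4 * Real.arctan (r * s⁻¹)) (𝓝[>] 0)
      (𝓝 (4 * (Real.pi / 2))) :=
    ((Real.tendsto_arctan_atTop.mono_right nhdsWithin_le_nhds).comp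
      (tendsto_inv_nhdsGT_zero.const_mul_atTop hr)).const_mul 4
  have h2 : (4 : ℝ) * (Real.pi / 2) = 2 * Real.pi := by ring
  rw [h2] at h1
  refine h1.congr' ?_
  filter_upwards [self_mem_nhdsWithin] with s hs using heq s hs

/-- Pointwise comparison of the jump kernel of a curve with the Poisson kernel. -/
theorem norm_jump_kernel_sub_poisson_le {w d : ℂ} {s t C m : ℝ} (hs : 0 < s) (hm : 0 < m)
    (hC : 0 ≤ C) (ht : |t| ≤ 1) (hd : ‖d - 1‖ ≤ C * |t|) (hw : ‖w - t‖ ≤ C * t ^ 2)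
    (h₁ : m * (t ^ 2 + s ^ 2) ≤ ‖w - s * Complex.I‖ ^ 2)
    (h₂ : m * (t ^ 2 + s ^ 2) ≤ ‖w + s * Complex.I‖ ^ 2) :
    ‖d / (w - s * Complex.I) - d / (w + s * Complex.I)
        - ((2 * s / (t ^ 2 + s ^ 2) : ℝ) : ℂ) * Complex.I‖ ≤
      2 * s * (C * (3 + C) * |t|) / (m * (t ^ 2 + s ^ 2)) := by
  have hpos : 0 < t ^ 2 + s ^ 2 := by positivity
  have hn₁ : w - s * Complex.I ≠ 0 := fun h => by
    rw [h] at h₁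
    simp only [norm_zero] at h₁
    nlinarith [mul_pos hm hpos]
  have hn₂ : w + s * Complex.I ≠ 0 := fun h => by
    rw [h] at h₂
    simp only [norm_zero] at h₂
    nlinarith [mul_pos hm hpos]
  have hts : (t ^ 2 + s ^ 2 : ℂ) ≠ 0 := by exact_mod_cast hpos.ne'
  have hden : m * (t ^ 2 + s ^ 2) ≤ ‖(w - s * Complex.I) * (w + s * Complex.I)‖ := by
    rw [norm_mul]
    refine le_of_sq_le_sq ?_ (by positivity)
    rw [mul_pow _ _ 2, mul_pow, ← mul_pow, sq (m * _)]
    gcongr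
  have heq : d / (w - s * Complex.I) - d / (w + s * Complex.I)
        - ((2 * s / (t ^ 2 + s ^ 2) : ℝ) : ℂ) * Complex.I =
      (2 * s * Complex.I) * ((d - 1) * (t ^ 2 + s ^ 2) + (t - w) * (t + w)) /
        (((w - s * Complex.I) * (w + s * Complex.I)) * (t ^ 2 + s ^ 2)) := by
    push_cast
    have hI : Complex.I ^ 2 = -1 := Complex.I_sq
    field_simp
    linear_combination (2 * s ^ 3 * Complex.I) * hI
  have hwt : ‖w‖ ≤ (1 + C) * |t| := by
    have h3 : ‖w‖ ≤ ‖w - t‖ + ‖(t : ℂ)‖ := by simpa using norm_add_le (w - t) (t : ℂ)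
    rw [Complex.norm_real, Real.norm_eq_abs] at h3
    have h4 : t ^ 2 ≤ |t| := by
      rw [← sq_abs]; nlinarith [abs_nonneg t]
    nlinarith [mul_le_mul_of_nonneg_left h4 hC]
  have hnum : ‖(d - 1) * (t ^ 2 + s ^ 2) + (t - w) * (t + w)‖ ≤
      C * (3 + C) * |t| * (t ^ 2 + s ^ 2) := by
    calc _ ≤ ‖d - 1‖ * ‖(t ^ 2 + s ^ 2 : ℂ)‖ + ‖(t - w : ℂ)‖ * ‖(t + w : ℂ)‖ := by
          rw [← norm_mul, ← norm_mul]; exact norm_add_le _ _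
      _ ≤ (C * |t|) * (t ^ 2 + s ^ 2) + (C * t ^ 2) * (|t| + (1 + C) * |t|) := by
          have e1 : ‖(t ^ 2 + s ^ 2 : ℂ)‖ = t ^ 2 + s ^ 2 := by
            have : (t ^ 2 + s ^ 2 : ℂ) = ((t ^ 2 + s ^ 2 : ℝ) : ℂ) := by push_cast; rfl
            rw [this, Complex.norm_real, Real.norm_of_nonneg hpos.le]
          have e2 : ‖(t + w : ℂ)‖ ≤ |t| + (1 + C) * |t| := by
            refine (norm_add_le _ _).trans ?_
            rw [Complex.norm_real, Real.norm_eq_abs]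
            gcongr
          rw [e1, norm_sub_rev (t : ℂ) w]
          gcongr
      _ ≤ _ := by
          have : 0 ≤ C * (2 + C) * |t| * s ^ 2 := by positivity
          nlinarith
  rw [heq, norm_div, norm_mul, norm_mul (_ * _) (t ^ 2 + s ^ 2 : ℂ)]
  have e1 : ‖(t ^ 2 + s ^ 2 : ℂ)‖ = t ^ 2 + s ^ 2 := by
    have : (t ^ 2 + s ^ 2 : ℂ) = ((t ^ 2 + s ^ 2 : ℝ) : ℂ) := by push_cast; rfl
    rw [this, Complex.norm_real, Real.norm_of_nonneg hpos.le]
  have e3 : ‖(2 * s * Complex.I : ℂ)‖ = 2 * s := by simp [abs_of_pos hs]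
  rw [e1, e3]
  calc _ ≤ 2 * s * (C * (3 + C) * |t| * (t ^ 2 + s ^ 2)) /
        ((m * (t ^ 2 + s ^ 2)) * (t ^ 2 + s ^ 2)) := by gcongr
    _ = _ := by field_simp

/-- The jump of the winding integral across a curve `u` with `u 0 = 0`, `u' 0 = 1` is `2πi`. -/
theorem tendsto_windingIntegral_jump {u : ℝ → ℂ} (hu : ContDiff ℝ 2 u) {r ρ C m : ℝ}
    (hr : 0 < r) (hr1 : r ≤ 1) (hC : 0 < C) (hm : 0 < m) (hm1 : m ≤ 1) (hρ : 0 < ρ)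
    (hup : ∀ t ∈ Icc (-r) r, ‖deriv u t - 1‖ ≤ C * |t| ∧ ‖u t - t‖ ≤ C * t ^ 2)
    (hlow : ∀ s : ℝ, |s| ≤ ρ → ∀ t ∈ Icc (-r) r,
      m * t ^ 2 + s ^ 2 ≤ ‖u t - s * Complex.I‖ ^ 2) :
    Tendsto (fun s : ℝ => (∫ t in (-r)..r, deriv u t / (u t - s * Complex.I)) -
      ∫ t in (-r)..r, deriv u t / (u t - (-s : ℝ) * Complex.I)) (𝓝[>] 0)
      (𝓝 (2 * Real.pi * Complex.I)) := by
  have hrr : -r ≤ r := by linarith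
  have hcont : Continuous u := hu.continuous
  have hcont' : Continuous (deriv u) := hu.continuous_deriv one_le_two
  have hne : ∀ s : ℝ, s ≠ 0 → |s| ≤ ρ → ∀ t ∈ Icc (-r) r, u t - s * Complex.I ≠ 0 := by
    intro s hs0 hs t ht h0
    have := hlow s hs t ht
    rw [h0, norm_zero] at this
    have h1 : 0 < s ^ 2 := by positivity
    have h2 : 0 ≤ m * t ^ 2 := by positivity
    linarith
  have hcts : ∀ s : ℝ, s ≠ 0 → |s| ≤ ρ →
      ContinuousOn (fun t => deriv u t / (u t - s * Complex.I)) (Icc (-r) r) := fun s hs0 hs =>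
    hcont'.continuousOn.div (by fun_prop) (hne s hs0 hs)
  have hpoisson : ∀ s : ℝ, 0 < s →
      Continuous (fun t : ℝ => ((2 * s / (t ^ 2 + s ^ 2) : ℝ) : ℂ) * Complex.I) := by
    intro s hs
    have : Continuous (fun t : ℝ => 2 * s / (t ^ 2 + s ^ 2)) :=
      Continuous.div (by fun_prop) (by fun_prop) fun t => by positivity
    fun_prop
  set D : ℝ → ℝ → ℂ := fun s t => deriv u t / (u t - s * Complex.I) -
    deriv u t / (u t - (-s : ℝ) * Complex.I) -
      ((2 * s / (t ^ 2 + s ^ 2) : ℝ) : ℂ) * Complex.I with hD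
  have hmem : ∀ᶠ s in 𝓝[>] (0 : ℝ), s ∈ Ioc 0 ρ := Ioc_mem_nhdsGT hρ
  have hDcts : ∀ s ∈ Ioc 0 ρ, ContinuousOn (D s) (Icc (-r) r) := by
    intro s hs
    have habs : |s| ≤ ρ := by rw [abs_of_pos hs.1]; exact hs.2
    exact ((hcts s hs.1.ne' habs).sub
      (hcts (-s) (neg_ne_zero.2 hs.1.ne') (by rwa [abs_neg]))).sub (hpoisson s hs.1).continuousOn
  have hDle : ∀ s ∈ Ioc 0 ρ, ∀ t ∈ Icc (-r) r,
      ‖D s t‖ ≤ 2 * s * (C * (3 + C) * |t|) / (m * (t ^ 2 + s ^ 2)) := by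
    intro s hs t ht
    have habs : |s| ≤ ρ := by rw [abs_of_pos hs.1]; exact hs.2
    have hms : m * s ^ 2 ≤ s ^ 2 := mul_le_of_le_one_left (sq_nonneg s) hm1
    have h1 := hlow s habs t ht
    have h2 := hlow (-s) (by rwa [abs_neg]) t ht
    have h3 : u t - (-s : ℝ) * Complex.I = u t + s * Complex.I := by push_cast; ring
    simp only [hD]
    rw [h3] at h2 ⊢
    exact norm_jump_kernel_sub_poisson_le hs.1 hm hC.le
      ((abs_le.2 ht).trans hr1) (hup t ht).1 (hup t ht).2 (by linarith) (by linarith)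
  have hlim : Tendsto (fun s => ∫ t in (-r)..r, D s t) (𝓝[>] 0)
      (𝓝 (∫ t in (-r)..r, (0 : ℂ))) := by
    refine intervalIntegral.tendsto_integral_filter_of_dominated_convergence
      (fun _ => C * (3 + C) / m) ?_ ?_ intervalIntegrable_const ?_
    · filter_upwards [hmem] with s hs
      rw [uIoc_of_le hrr]
      exact ((hDcts s hs).mono Ioc_subset_Icc_self).aestronglyMeasurable measurableSet_Ioc
    · filter_upwards [hmem] with s hs
      refine Eventually.of_forall fun t ht => ?_
      rw [uIoc_of_le hrr] at ht
      refine (hDle s hs t (Ioc_subset_Icc_self ht)).trans ?_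
      have hpos : 0 < t ^ 2 + s ^ 2 := by have := hs.1; positivity
      rw [div_le_div_iff₀ (by positivity) hm]
      have h1 : 2 * s * |t| ≤ t ^ 2 + s ^ 2 := by
        rw [← sq_abs t]; nlinarith [sq_nonneg (|t| - s)]
      have h2 : 0 ≤ C * (3 + C) * m := by positivity
      nlinarith [mul_le_mul_of_nonneg_left h1 h2]
    · refine Eventually.of_forall fun t ht => ?_
      rw [uIoc_of_le hrr] at ht
      have hsq : Tendsto (fun s : ℝ => 2 * s * (C * (3 + C) * |t|) / (m * (t ^ 2 + s ^ 2)))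
          (𝓝[>] 0) (𝓝 0) := by
        rcases eq_or_ne t 0 with rfl | ht0
        · simp
        · have hc : ContinuousAt
              (fun s : ℝ => 2 * s * (C * (3 + C) * |t|) / (m * (t ^ 2 + s ^ 2))) 0 :=
            ContinuousAt.div (by fun_prop) (by fun_prop) (by positivity)
          have := hc.tendsto.mono_left (nhdsWithin_le_nhds (s := Ioi 0))
          simpa using this
      refine squeeze_zero_norm' ?_ hsq
      filter_upwards [hmem] with s hs using hDle s hs t (Ioc_subset_Icc_self ht)
  have hP : Tendsto (fun s : ℝ => ((∫ t in (-r)..r, 2 * s / (t ^ 2 + s ^ 2) : ℝ) : ℂ) * Complex.I)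
      (𝓝[>] 0) (𝓝 (((2 * Real.pi : ℝ) : ℂ) * Complex.I)) :=
    ((Complex.continuous_ofReal.tendsto _).comp (tendsto_integral_poisson hr)).mul_const _
  have hsum := hlim.add hP
  rw [intervalIntegral.integral_zero, zero_add] at hsum
  push_cast at hsum
  refine hsum.congr' ?_
  filter_upwards [hmem] with s hs
  have habs : |s| ≤ ρ := by rw [abs_of_pos hs.1]; exact hs.2
  have i1 := (hcts s hs.1.ne' habs).intervalIntegrable_of_Icc (μ := volume) hrr
  have i2 := (hcts (-s) (neg_ne_zero.2 hs.1.ne') (by rwa [abs_neg])).intervalIntegrable_of_Icc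
    (μ := volume) hrr
  have i3 := (hpoisson s hs.1).intervalIntegrable (μ := volume) (-r) r
  have e1 : ∫ t in (-r)..r, D s t = _ := intervalIntegral.integral_sub (i1.sub i2) i3
  rw [e1, intervalIntegral.integral_sub i1 i2, intervalIntegral.integral_mul_const]
  rw [intervalIntegral.integral_ofReal]
  push_cast
  ring

/-- A connected open set avoiding a regular simple closed curve through `0` with tangent `1` there
avoids a disc touching the curve at `0`. -/
theorem exists_touching_disc_of_normalized {u : ℝ → ℂ} (hu : ContDiff ℝ 2 u) (h0 : u 0 = 0)
    (h1 : deriv u 0 = 1) {r : ℝ} (hr : 0 < r) (hr1 : r ≤ 1)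
    (hne : ∀ t ∈ Icc (-r) r, t ≠ 0 → u t ≠ 0) (hclosed : u (-r) = u r) {V : Set ℂ}
    (hV : IsOpen V) (hVc : IsPreconnected V) (hdisj : ∀ t ∈ Icc (-r) r, u t ∉ V) :
    ∃ c : ℂ, c ≠ 0 ∧ Disjoint (Metric.ball c ‖c‖) V := by
  obtain ⟨C, hC, hup⟩ := exists_taylor_bounds hu h0 h1 r
  obtain ⟨k, hk, hklow⟩ := exists_mul_sq_le_norm_sq hu h0 h1 hr.le hne
  obtain ⟨ρ, hρ, m, hm, hm1, hlow⟩ :=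
    exists_le_norm_sub_mul_I_sq hC hk (fun t ht => (hup t ht).2) hklow
  by_contra! hcon
  have hnorm : ∀ s : ℝ, ‖(s : ℂ) * Complex.I‖ = |s| := fun s => by simp
  have hmeet : ∀ s : ℝ, s ≠ 0 →
      (Metric.ball ((s : ℂ) * Complex.I) |s| ∩ V).Nonempty := by
    intro s hs
    have := hcon ((s : ℂ) * Complex.I) (by simp [hs])
    rwa [hnorm, not_disjoint_iff_nonempty_inter] at this
  have havoid : ∀ s : ℝ, |s| ≤ ρ → ∀ t ∈ Icc (-r) r,
      u t ∉ Metric.ball ((s : ℂ) * Complex.I) |s| := by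
    intro s hs t ht hmem
    rw [mem_ball_iff_norm] at hmem
    have h2 := hlow s hs t ht
    have h3 : 0 ≤ m * t ^ 2 := by positivity
    have h4 : ‖u t - s * Complex.I‖ ^ 2 < |s| ^ 2 := by gcongr
    rw [sq_abs] at h4
    linarith
  set W : Set ℂ := Metric.ball ((ρ : ℂ) * Complex.I) |ρ| ∪ V ∪
    Metric.ball (((-ρ : ℝ) : ℂ) * Complex.I) |(-ρ)| with hW
  have hWo : IsOpen W := (Metric.isOpen_ball.union hV).union Metric.isOpen_ball
  have hWc : IsPreconnected W := by
    have hb : ∀ c : ℂ, ∀ R : ℝ, IsPreconnected (Metric.ball c R) := fun c R =>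
      (convex_ball c R).isPreconnected
    refine IsPreconnected.union' ?_ (IsPreconnected.union' (hmeet ρ hρ.ne') (hb _ _) hVc) (hb _ _)
    obtain ⟨z, hz1, hz2⟩ := hmeet (-ρ) (neg_ne_zero.2 hρ.ne')
    exact ⟨z, Or.inr hz2, hz1⟩
  have hWu : ∀ z ∈ W, ∀ t ∈ Icc (-r) r, u t ≠ z := by
    rintro z ((hz | hz) | hz) t ht rfl
    · exact havoid ρ (abs_of_pos hρ).le t ht hz
    · exact hdisj t ht hz
    · exact havoid (-ρ) (by rw [abs_neg, abs_of_pos hρ]) t ht hz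
  have hder : ∀ z ∈ W, HasDerivAt (fun w => ∫ t in (-r)..r, deriv u t / (u t - w)) 0 z :=
    fun z hz => hasDerivAt_windingIntegral (hu.of_le one_le_two) hclosed (by linarith) (hWu z hz)
  have hconst : ∀ z ∈ W, ∀ w ∈ W, (∫ t in (-r)..r, deriv u t / (u t - z)) =
      ∫ t in (-r)..r, deriv u t / (u t - w) := fun z hz w hw =>
    hWo.is_const_of_deriv_eq_zero hWc
      (fun z hz => (hder z hz).differentiableAt.differentiableWithinAt)
      (fun z hz => (hder z hz).deriv) hz hw
  have hlim := tendsto_windingIntegral_jump hu hr hr1 hC hm hm1 hρ hup hlow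
  have hzero : (2 * Real.pi * Complex.I : ℂ) = 0 := by
    refine tendsto_nhds_unique hlim (tendsto_const_nhds.congr' ?_)
    filter_upwards [Ioc_mem_nhdsGT hρ] with s hs
    have hball : ∀ a b : ℝ, |a - b| < |b| →
        (a : ℂ) * Complex.I ∈ Metric.ball ((b : ℂ) * Complex.I) |b| := by
      intro a b hab
      rw [mem_ball_iff_norm, ← sub_mul, ← Complex.ofReal_sub, hnorm]
      exact hab
    have hlt : |s - ρ| < |ρ| := by
      rw [abs_of_pos hρ, abs_lt]
      constructor <;> linarith [hs.1, hs.2]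
    refine (sub_eq_zero.2 (hconst _ (Or.inl (Or.inl (hball s ρ hlt))) _
      (Or.inr (hball (-s) (-ρ) ?_)))).symm
    rwa [← neg_sub', abs_neg, abs_neg]
  simp [Real.pi_ne_zero] at hzero

/-- A connected open set avoiding a regular simple closed curve avoids a disc touching the curve
at any prescribed point of it. -/
theorem exists_touching_disc {γ : ℝ → ℂ} (hγ : ContDiff ℝ 2 γ) (hper : Function.Periodic γ 1)
    (hinj : ∀ s ∈ Ico (0 : ℝ) 1, ∀ t ∈ Ico (0 : ℝ) 1, γ s = γ t → s = t) {t₀ : ℝ}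
    (hreg : deriv γ t₀ ≠ 0) {Ω : Set ℂ} (hΩ : IsOpen Ω) (hΩc : IsPreconnected Ω)
    (hdisj : ∀ t, γ t ∉ Ω) :
    ∃ c : ℂ, c ≠ γ t₀ ∧ Disjoint (Metric.ball c ‖γ t₀ - c‖) Ω := by
  set v := deriv γ t₀ with hv
  set u : ℝ → ℂ := fun t => (γ (t₀ + t) - γ t₀) / v with hu_def
  have hu : ContDiff ℝ 2 u := by
    have : ContDiff ℝ 2 (fun t => γ (t₀ + t)) := hγ.comp (by fun_prop)
    exact (this.sub contDiff_const).div_const v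
  have hd0 : deriv u 0 = 1 := by
    have h1 : HasDerivAt (fun t => γ (t₀ + t)) v 0 :=
      HasDerivAt.comp_const_add t₀ 0
        (by rw [add_zero]; exact (hγ.differentiable two_ne_zero t₀).hasDerivAt)
    rw [((h1.sub_const (γ t₀)).div_const v).deriv, div_self hreg]
  have hfract : ∀ t, γ (Int.fract t) = γ t := fun t => by
    have := hper.sub_zsmul_eq (x := t) ⌊t⌋
    rwa [zsmul_one] at this
  have hne : ∀ t ∈ Icc (-(1 / 2 : ℝ)) (1 / 2), t ≠ 0 → u t ≠ 0 := by
    intro t ht ht0 hut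
    have h1 : γ (t₀ + t) = γ t₀ := by
      rcases div_eq_zero_iff.1 hut with h | h
      · exact sub_eq_zero.1 h
      · exact absurd h hreg
    rw [← hfract (t₀ + t), ← hfract t₀] at h1
    have h2 := hinj _ ⟨Int.fract_nonneg _, Int.fract_lt_one _⟩ _
      ⟨Int.fract_nonneg _, Int.fract_lt_one _⟩ h1
    obtain ⟨z, hz⟩ := Int.fract_eq_fract.1 h2
    rw [add_sub_cancel_left] at hz
    have h3 : |(z : ℝ)| < 1 := by
      rw [← hz]
      exact (abs_le.2 ht).trans_lt (by norm_num)
    have h4 : z = 0 := Int.abs_lt_one_iff.1 (by exact_mod_cast h3)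
    exact ht0 (by rw [hz, h4, Int.cast_zero])
  have hclosed : u (-(1 / 2)) = u (1 / 2) := by
    have : γ (t₀ + -(1 / 2)) = γ (t₀ + 1 / 2) := by
      rw [← hper (t₀ + -(1 / 2))]
      congr 1
      ring
    simp only [hu_def, this]
  set φ : ℂ → ℂ := fun z => γ t₀ + v * z with hφ
  have himg : φ ⁻¹' Ω = (fun z => (z - γ t₀) / v) '' Ω := by
    ext z
    constructor
    · intro hz
      refine ⟨φ z, hz, ?_⟩
      simp only [hφ]
      field_simp
      ring
    · rintro ⟨w, hw, rfl⟩
      have : φ ((w - γ t₀) / v) = w := by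
        simp only [hφ]
        field_simp
        ring
      rwa [mem_preimage, this]
  obtain ⟨c, hc0, hc⟩ := exists_touching_disc_of_normalized hu (by simp [hu_def]) hd0
    (r := 1 / 2) (by norm_num) (by norm_num) hne hclosed
    (V := φ ⁻¹' Ω) (hΩ.preimage (by fun_prop))
    (himg ▸ hΩc.image _ (by fun_prop)) (fun t _ ht => hdisj (t₀ + t) (by
      have : φ (u t) = γ (t₀ + t) := by
        simp only [hφ, hu_def]
        field_simp
        ring
      rwa [mem_preimage, this] at ht))
  refine ⟨φ c, by simp [hφ, hreg, hc0], Set.disjoint_left.2 fun z hz hzΩ => ?_⟩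
  have hz' : z = φ ((z - γ t₀) / v) := by
    simp only [hφ]
    field_simp
    ring
  have hmem : (z - γ t₀) / v ∈ φ ⁻¹' Ω := by rwa [mem_preimage, ← hz']
  refine Set.disjoint_left.1 hc ?_ hmem
  rw [mem_ball_iff_norm] at hz ⊢
  have e1 : ‖γ t₀ - φ c‖ = ‖v‖ * ‖c‖ := by simp [hφ]
  have e2 : z - φ c = v * ((z - γ t₀) / v - c) := by
    simp only [hφ]
    field_simp
    ring
  rw [e1, e2, norm_mul] at hz
  exact lt_of_mul_lt_mul_left hz (norm_nonneg v)

/-- let `A` be a contraction on a finite-dimensional (complex) Hilbert space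
whose spectrum is contained in the boundary `∂Ω` of a bounded domain `Ω ⊂ ℂ`, and suppose
`clos Ω` is a spectral set for `A` (i.e. `‖r(A)‖ ≤ sup_{clos Ω} |r|` for every rational
function `r = p/q` with poles off `clos Ω`).  If `∂Ω` is a finite union of smooth simple
closed curves, then `A` is normal. -/
theorem contraction_with_boundary_spectrum_and_spectral_set_is_normal
    (E : Type*) [NormedAddCommGroup E] [InnerProductSpace ℂ E] [FiniteDimensional ℂ E]
    (A : E →L[ℂ] E) (hA : ‖A‖ ≤ 1)
    (Ω : Set ℂ) (hopen : IsOpen Ω) (hconn : IsConnected Ω) (hbdd : Bornology.IsBounded Ω)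
    (hspec : spectrum ℂ A ⊆ frontier Ω)
    (hspectralSet : ∀ p q : Polynomial ℂ, (∀ z ∈ closure Ω, q.eval z ≠ 0) →
      ∀ B : E →L[ℂ] E,
        (aeval A q) * B = 1 → B * (aeval A q) = 1 →
        ∀ M : ℝ, (∀ z ∈ closure Ω, ‖p.eval z / q.eval z‖ ≤ M) → ‖(aeval A p) * B‖ ≤ M)
    (hboundary : ∃ (N : ℕ) (γ : Fin N → ℝ → ℂ),
      (∀ i, ContDiff ℝ (⊤ : ℕ∞) (γ i)) ∧
      (∀ i, Function.Periodic (γ i) 1) ∧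
      (∀ i, ∀ s ∈ Ico (0 : ℝ) 1, ∀ t ∈ Ico (0 : ℝ) 1, γ i s = γ i t → s = t) ∧
      (∀ i t, deriv (γ i) t ≠ 0) ∧
      frontier Ω = ⋃ i, range (γ i)) :
    IsStarNormal A := by
  obtain ⟨N, γ, hsmooth, hper, hinj, hreg, hfr⟩ := hboundary
  refine isStarNormal_of_adjoint_apply_eigenvector fun μ x hx => ?_
  rcases eq_or_ne x 0 with rfl | hx0
  · simp
  have hμ : μ ∈ spectrum ℂ A := by
    intro hunit
    obtain ⟨u, hu⟩ := hunit
    have h1 : (u : E →L[ℂ] E) x = 0 := by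
      rw [hu, sub_apply, hx, Algebra.algebraMap_eq_smul_one]
      simp
    have h2 : (↑u⁻¹ : E →L[ℂ] E) ((u : E →L[ℂ] E) x) = x := by
      rw [← mul_apply_eq_comp, u.inv_mul]; simp
    rw [h1, map_zero] at h2
    exact hx0 h2.symm
  have hμfr := hspec hμ
  rw [hfr] at hμfr
  obtain ⟨i, t₀, rfl⟩ := mem_iUnion.1 hμfr
  obtain ⟨c, hc, hdisc⟩ := exists_touching_disc (contDiff_infty.1 (hsmooth i) 2)
    (hper i) (hinj i) (hreg i t₀) hopen hconn.isPreconnected (fun t ht => by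
      have : γ i t ∈ frontier Ω := hfr ▸ mem_iUnion.2 ⟨i, t, rfl⟩
      rw [hopen.frontier_eq] at this
      exact this.2 ht)
  exact adjoint_apply_eigenvector_of_exterior_disc hspec hspectralSet hc hdisc hx
end
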